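/- arXiv:2105.00481 — 6 statements merged into one kernel-verified Lean document; each statement's English description precedes it below -/
import Mathlib

section
/- Let k, s, p and n be positive integers with n ≥ (s+1)k. Then for every nested overlapping sequence of families ℬ₀ ⊆ ℬ₁ ⊆ … ⊆ ℬ_s of k-element subsets of [n] = {1,…,n}, one has p·|ℬ₀| + |ℬ₁| + … + |ℬ_s| ≤ max{ s·C(n,k), (p+s)·s·C(n−1,k−1) }, where C(a,b) denotes the binomial coefficient. -/
/-- A sequence of families `𝒜 0, …, 𝒜 (m-1)` of subsets of the ground type `α`
admits a rainbow matching of size `t` if one can pick `t` distinct families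
(in increasing order of index) and pairwise disjoint members, one from each. -/
def HasRainbowMatching {α : Type*} [DecidableEq α] {m : ℕ}
    (𝒜 : Fin m → Finset (Finset α)) (t : ℕ) : Prop :=
  ∃ (idx : Fin t → Fin m) (f : Fin t → Finset α),
    StrictMono idx ∧ (∀ a, f a ∈ 𝒜 (idx a)) ∧
    ∀ a b, a ≠ b → Disjoint (f a) (f b)

/-- Two starting points `x`, `y` on a cycle of length `n` are separated when the arcs of
length `k` starting at them are disjoint. -/
def ArcSep (k n x y : ℕ) : Prop :=
  (x + k ≤ y ∧ y + k ≤ x + n) ∨ (y + k ≤ x ∧ x + k ≤ y + n)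

/-- The sets `B i` of starting points admit pairwise separated representatives. -/
def HasSepTransversal {ι : Type*} (k n : ℕ) (B : ι → Finset ℕ) : Prop :=
  ∃ f : ι → ℕ, (∀ i, f i ∈ B i) ∧ ∀ i j, i ≠ j → ArcSep k n (f i) (f j)

/-- The increasing map of `ℕ` that omits the value `d`. -/
def skipAt (d x : ℕ) : ℕ := if x < d then x else x + 1

/-- The set of starting points left in a cycle of length `n` after contracting `d`. -/
def contractAt (n d : ℕ) (S : Finset ℕ) : Finset ℕ :=
  (Finset.range n).filter fun x => skipAt d x ∈ S

theorem skipAt_injective (d : ℕ) : Function.Injective (skipAt d) := by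
  intro x y h
  unfold skipAt at h
  split_ifs at h <;> omega

theorem ArcSep.skipAt {k n d x y : ℕ} (hk : 0 < k) (h : ArcSep k n x y) :
    ArcSep k (n + 1) (skipAt d x) (skipAt d y) := by
  unfold ArcSep at *
  unfold _root_.skipAt
  split_ifs <;> omega

theorem image_skipAt_contractAt {n d : ℕ} (hd : d < n + 1) {S : Finset ℕ}
    (hS : S ⊆ Finset.range (n + 1)) : (contractAt n d S).image (skipAt d) = S.erase d := by
  ext y
  simp only [contractAt, Finset.mem_image, Finset.mem_filter, Finset.mem_range, Finset.mem_erase]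
  constructor
  · rintro ⟨x, ⟨hx, hxS⟩, rfl⟩
    refine ⟨?_, hxS⟩
    unfold skipAt
    split_ifs <;> omega
  · rintro ⟨hyd, hyS⟩
    have hy := Finset.mem_range.1 (hS hyS)
    have key : skipAt d (if y < d then y else y - 1) = y := by
      unfold skipAt
      split_ifs <;> omega
    refine ⟨if y < d then y else y - 1, ⟨?_, by rwa [key]⟩, key⟩
    split_ifs <;> omega

theorem card_contractAt {n d : ℕ} (hd : d < n + 1) {S : Finset ℕ}
    (hS : S ⊆ Finset.range (n + 1)) : (contractAt n d S).card = (S.erase d).card := by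
  rw [← image_skipAt_contractAt hd hS, Finset.card_image_of_injective _ (skipAt_injective d)]

theorem contractAt_range (n d : ℕ) : contractAt n d (Finset.range (n + 1)) = Finset.range n := by
  ext x
  simp only [contractAt, Finset.mem_filter, Finset.mem_range, skipAt]
  split_ifs <;> omega

theorem contractAt_subset_range (n d : ℕ) (S : Finset ℕ) :
    contractAt n d S ⊆ Finset.range n :=
  Finset.filter_subset _ _

theorem contractAt_mono (n d : ℕ) : Monotone (contractAt n d) := by
  intro S T h x
  simp only [contractAt, Finset.mem_filter]
  exact fun hx => ⟨hx.1, h hx.2⟩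

theorem HasSepTransversal.of_contractAt {ι : Type*} {k n d : ℕ} (hk : 0 < k)
    {B : ι → Finset ℕ} (h : HasSepTransversal k n fun i => contractAt n d (B i)) :
    HasSepTransversal k (n + 1) B := by
  obtain ⟨f, hf, hsep⟩ := h
  exact ⟨fun i => skipAt d (f i), fun i => (Finset.mem_filter.1 (hf i)).2,
    fun i j hij => (hsep i j hij).skipAt hk⟩

/-- If the `i`-th of finitely many sets has more than `i` elements for every `i`, then the sets
have distinct representatives. -/
theorem exists_injective_of_lt_card {m : ℕ} {α : Type*} [DecidableEq α] {T : Fin m → Finset α}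
    (hcard : ∀ i : Fin m, (i : ℕ) + 1 ≤ (T i).card) :
    ∃ f : Fin m → α, Function.Injective f ∧ ∀ i, f i ∈ T i := by
  rw [← Finset.all_card_le_biUnion_card_iff_exists_injective]
  intro S
  rcases S.eq_empty_or_nonempty with rfl | hS
  · simp
  · have h1 : S ⊆ Finset.Iic (S.max' hS) := fun i hi => Finset.mem_Iic.2 (S.le_max' i hi)
    have h2 := Finset.card_le_card h1
    rw [Fin.card_Iic] at h2
    exact h2.trans ((hcard _).trans
      (Finset.card_le_card (Finset.subset_biUnion_of_mem T (S.max'_mem hS))))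

/-- The indices `t < m` for which the point `c + k * t` lies in `S`. -/
def residueTrace (k m c : ℕ) (S : Finset ℕ) : Finset ℕ :=
  (Finset.range m).filter fun t => c + k * t ∈ S

theorem card_eq_sum_card_residueTrace {k m : ℕ} (hk : 0 < k) {S : Finset ℕ}
    (hS : S ⊆ Finset.range (m * k)) :
    S.card = ∑ c ∈ Finset.range k, (residueTrace k m c S).card := by
  rw [Finset.card_eq_sum_card_fiberwise (f := fun x => x % k) (t := Finset.range k)
    (fun x _ => by simpa using Nat.mod_lt x hk)]
  refine Finset.sum_congr rfl fun c hc => ?_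
  have hc := Finset.mem_range.1 hc
  symm
  refine Finset.card_bij (fun t _ => c + k * t) ?_ ?_ ?_
  · intro t ht
    simp only [residueTrace, Finset.mem_filter] at ht ⊢
    exact ⟨ht.2, by rw [Nat.add_mul_mod_self_left, Nat.mod_eq_of_lt hc]⟩
  · intro a _ b _ h
    exact Nat.eq_of_mul_eq_mul_left hk (Nat.add_left_cancel h)
  · intro x hx
    simp only [Finset.mem_filter] at hx
    have hdm := Nat.mod_add_div x k
    rw [hx.2] at hdm
    refine ⟨x / k, ?_, hdm⟩
    simp only [residueTrace, Finset.mem_filter, Finset.mem_range, hdm]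
    exact ⟨Nat.div_lt_of_lt_mul (by simpa [mul_comm] using Finset.mem_range.1 (hS hx.1)), hx.1⟩

theorem residueTrace_mono (k m c : ℕ) : Monotone (residueTrace k m c) := by
  intro S T h x
  simp only [residueTrace, Finset.mem_filter]
  exact fun hx => ⟨hx.1, h hx.2⟩

theorem arcSep_of_ne {k m n c t u : ℕ} (hmn : m * k ≤ n) (ht : t < m) (hu : u < m)
    (h : t ≠ u) : ArcSep k n (c + k * t) (c + k * u) := by
  have aux : ∀ {a b : ℕ}, a < b → b < m → c + k * a + k ≤ c + k * b ∧
      c + k * b + k ≤ c + k * a + n := by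
    intro a b hab hb
    have h1 : k * (a + 1) ≤ k * b := Nat.mul_le_mul_left k hab
    have h2 : k * (b + 1) ≤ k * m := Nat.mul_le_mul_left k hb
    rw [mul_comm k m] at h2
    rw [Nat.mul_succ] at h1 h2
    omega
  rcases lt_or_gt_of_ne h with h | h
  · exact Or.inl (aux h hu)
  · exact Or.inr (aux h ht)

theorem exists_card_residueTrace_le {m k c : ℕ} {B : Fin m → Finset ℕ}
    (hno : ¬ HasSepTransversal k (m * k) B) :
    ∃ i : Fin m, (residueTrace k m c (B i)).card ≤ i := by
  by_contra! hcon
  obtain ⟨f, hf, hmem⟩ := exists_injective_of_lt_card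
    (T := fun i => residueTrace k m c (B i)) hcon
  simp only [residueTrace, Finset.mem_filter, Finset.mem_range] at hmem
  exact hno ⟨fun i => c + k * f i, fun i => (hmem i).2,
    fun i j hij => arcSep_of_ne le_rfl (hmem i).1 (hmem j).1 (hf.ne hij)⟩

theorem exists_notMem_of_not_hasSepTransversal {s k n : ℕ} (hk : 0 < k) (hn : (s + 1) * k ≤ n)
    {B : Fin (s + 1) → Finset ℕ} (hB : Monotone B)
    (hno : ¬ HasSepTransversal k n B) : ∃ d < n, d ∉ B 0 := by
  by_contra! hcon
  refine hno ⟨fun i => 0 + k * i, fun i => hB (Fin.zero_le i) (hcon _ ?_),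
    fun i j hij => arcSep_of_ne hn i.2 j.2 (Fin.val_ne_of_ne hij)⟩
  have := Nat.mul_lt_mul_of_pos_left i.2 hk
  rw [mul_comm k (s + 1)] at this
  beta_reduce
  omega

/-- If all sets after the `j`-th are full, the smallest one has at most `j * k` points. -/
theorem card_zero_le_of_full {s k : ℕ} (hk : 0 < k) (j : Fin (s + 1)) (r : ℕ) :
    ∀ {B : Fin (s + 1) → Finset ℕ}, Monotone B →
      (∀ i, B i ⊆ Finset.range ((s + 1) * k + r)) →
      (∀ i, j < i → B i = Finset.range ((s + 1) * k + r)) →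
      ¬ HasSepTransversal k ((s + 1) * k + r) B → (B 0).card ≤ j * k := by
  induction r with
  | zero =>
    intro B hB hsub hfull hno
    rw [card_eq_sum_card_residueTrace hk (hsub 0)]
    have : ∀ c ∈ Finset.range k, (residueTrace k (s + 1) c (B 0)).card ≤ j := by
      intro c hc
      obtain ⟨i, hi⟩ := exists_card_residueTrace_le (c := c) hno
      rcases le_or_gt i j with hij | hij
      · exact (Finset.card_le_card (residueTrace_mono _ _ _ (hB (Fin.zero_le i)))).trans
          (hi.trans hij)
      · exfalso
        have hall : residueTrace k (s + 1) c (B i) = Finset.range (s + 1) := by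
          rw [hfull i hij]
          refine Finset.filter_true_of_mem fun t ht => ?_
          have h1 := Finset.mem_range.1 hc
          have h2 : k * (t + 1) ≤ k * (s + 1) :=
            Nat.mul_le_mul_left k (Finset.mem_range.1 ht)
          rw [mul_comm k (s + 1), Nat.mul_succ] at h2
          rw [Finset.mem_range]
          omega
        rw [hall, Finset.card_range] at hi
        have := i.2
        omega
    calc _ ≤ ∑ _c ∈ Finset.range k, (j : ℕ) := Finset.sum_le_sum this
      _ = j * k := by simp [mul_comm]
  | succ r ih =>
    intro B hB hsub hfull hno
    obtain ⟨d, hd, hd0⟩ := exists_notMem_of_not_hasSepTransversal hk (by omega) hB hno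
    have h := ih (B := fun i => contractAt ((s + 1) * k + r) d (B i))
      ((contractAt_mono _ _).comp hB) (fun i => contractAt_subset_range _ _ _)
      (fun i hi => by
        simp only [hfull i hi]
        exact contractAt_range _ _)
      (fun h => hno (h.of_contractAt hk))
    have hcard : (contractAt ((s + 1) * k + r) d (B 0)).card = (B 0).card := by
      rw [card_contractAt (n := (s + 1) * k + r) hd (hsub 0), Finset.erase_eq_of_notMem hd0]
    exact hcard ▸ h

theorem mul_card_zero_add_le {s k : ℕ} (hk : 0 < k) (r : ℕ) :
    ∀ {B : Fin (s + 1) → Finset ℕ}, Monotone B →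
      (∀ i, B i ⊆ Finset.range ((s + 1) * k + r)) →
      ¬ HasSepTransversal k ((s + 1) * k + r) B →
      r * (B 0).card + k * ∑ i, (B i).card ≤ s * k * ((s + 1) * k + r) := by
  induction r with
  | zero =>
    intro B hB hsub hno
    have hclass : ∀ c ∈ Finset.range k,
        ∑ i, (residueTrace k (s + 1) c (B i)).card ≤ s * (s + 1) := by
      intro c _
      obtain ⟨i, hi⟩ := exists_card_residueTrace_le (c := c) hno
      have hle : ∀ l : Fin (s + 1), (residueTrace k (s + 1) c (B l)).card ≤
          if l ≤ i then (i : ℕ) else s + 1 := by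
        intro l
        split_ifs with hl
        · exact (Finset.card_le_card (residueTrace_mono _ _ _ (hB hl))).trans hi
        · exact (Finset.card_le_card (Finset.filter_subset _ _)).trans (by simp)
      refine (Finset.sum_le_sum fun l _ => hle l).trans ?_
      rw [Finset.sum_ite, Finset.sum_const, Finset.sum_const]
      have e1 : (Finset.univ.filter fun l : Fin (s + 1) => l ≤ i) = Finset.Iic i := by
        ext; simp
      have e2 : (Finset.univ.filter fun l : Fin (s + 1) => ¬ l ≤ i) = Finset.Ioi i := by
        ext; simp
      rw [e1, e2, Fin.card_Iic, Fin.card_Ioi, smul_eq_mul, smul_eq_mul]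
      obtain ⟨q, hq⟩ := Nat.exists_eq_add_of_le (Nat.le_of_lt_succ i.2)
      have : s + 1 - 1 - (i : ℕ) = q := by omega
      rw [this]
      generalize (i : ℕ) = a at *
      subst hq
      nlinarith [Nat.zero_le (a * q)]
    have : ∑ i, (B i).card ≤ k * (s * (s + 1)) := by
      calc ∑ i, (B i).card
          = ∑ i, ∑ c ∈ Finset.range k, (residueTrace k (s + 1) c (B i)).card :=
            Finset.sum_congr rfl fun i _ => card_eq_sum_card_residueTrace hk (hsub i)
        _ = ∑ c ∈ Finset.range k, ∑ i, (residueTrace k (s + 1) c (B i)).card :=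
            Finset.sum_comm
        _ ≤ ∑ _c ∈ Finset.range k, s * (s + 1) := Finset.sum_le_sum hclass
        _ = k * (s * (s + 1)) := by simp
    calc 0 * (B 0).card + k * ∑ i, (B i).card ≤ k * (k * (s * (s + 1))) := by
          rw [zero_mul, zero_add]
          exact Nat.mul_le_mul_left k this
      _ = s * k * ((s + 1) * k + 0) := by ring
  | succ r ih =>
    intro B hB hsub hno
    set n := (s + 1) * k + r with hn
    obtain ⟨d₀, hd₀, hd₀0⟩ := exists_notMem_of_not_hasSepTransversal hk (by omega) hB hno
    let J : Finset (Fin (s + 1)) := Finset.univ.filter fun i => B i ≠ Finset.range (n + 1)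
    have hJ : J.Nonempty := ⟨0, by
      simp only [J, Finset.mem_filter, Finset.mem_univ, true_and]
      intro h
      exact hd₀0 (h ▸ Finset.mem_range.2 hd₀)⟩
    set j := J.max' hJ with hj
    have hjJ : B j ≠ Finset.range (n + 1) := (Finset.mem_filter.1 (J.max'_mem hJ)).2
    have hfull : ∀ i, j < i → B i = Finset.range (n + 1) := by
      intro i hi
      by_contra hne
      exact absurd (J.le_max' i (by simp [J, hne])) (not_le.2 hi)
    obtain ⟨d, hd, hdj⟩ : ∃ d ∈ Finset.range (n + 1), d ∉ B j := by
      by_contra! hcon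
      exact hjJ (Finset.Subset.antisymm (hsub j) hcon)
    rw [Finset.mem_range] at hd
    have hzero := card_zero_le_of_full hk j (r + 1) hB hsub hfull hno
    have h := ih (B := fun i => contractAt n d (B i))
      ((contractAt_mono _ _).comp hB) (fun i => contractAt_subset_range _ _ _)
      (fun h => hno (h.of_contractAt hk))
    have hcard : ∀ i, (B i).card =
        (contractAt n d (B i)).card + if j < i then 1 else 0 := by
      intro i
      rw [card_contractAt hd (hsub i)]
      split_ifs with hi
      · rw [Finset.card_erase_add_one]
        rw [hfull i hi]
        exact Finset.mem_range.2 hd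
      · rw [Finset.erase_eq_of_notMem fun hmem => hdj (hB (not_lt.1 hi) hmem), add_zero]
    have hsum : ∑ i, (B i).card = ∑ i, (contractAt n d (B i)).card + (s - j) := by
      rw [Finset.sum_congr rfl fun i _ => hcard i, Finset.sum_add_distrib]
      congr 1
      rw [← Finset.sum_filter, Finset.sum_const]
      have e2 : (Finset.univ.filter fun l : Fin (s + 1) => j < l) = Finset.Ioi j := by
        ext; simp
      rw [e2, Fin.card_Ioi]
      simp
    have hc0 := hcard 0
    rw [if_neg (Fin.not_lt_zero j), add_zero] at hc0
    simp only [← hc0] at h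
    rw [hsum]
    obtain ⟨q, hq⟩ := Nat.exists_eq_add_of_le (Nat.le_of_lt_succ j.2)
    have hq' : s - (j : ℕ) = q := by omega
    rw [hq']
    have hsk : s * k = j * k + q * k := by rw [← add_mul, ← hq]
    calc (r + 1) * (B 0).card + k * (∑ i, (contractAt n d (B i)).card + q)
        = (r * (B 0).card + k * ∑ i, (contractAt n d (B i)).card) + ((B 0).card + q * k) := by
          ring
      _ ≤ s * k * n + s * k := by omega
      _ = s * k * (n + 1) := by ring

/-- The extremal inequality for families of arcs on a cycle. -/
theorem weighted_card_le_max {s k n p : ℕ} (hk : 0 < k) (hn : (s + 1) * k ≤ n)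
    {B : Fin (s + 1) → Finset ℕ} (hB : Monotone B) (hsub : ∀ i, B i ⊆ Finset.range n)
    (hno : ¬ HasSepTransversal k n B) :
    p * (B 0).card + ∑ i : Fin s, (B i.succ).card ≤ max (s * n) ((p + s) * s * k) := by
  obtain ⟨r, rfl⟩ := Nat.exists_eq_add_of_le hn
  have h1 := mul_card_zero_add_le hk r hB hsub hno
  have h2 := card_zero_le_of_full hk (Fin.last s) r hB hsub
    (fun i hi => absurd hi (not_lt.2 (Fin.le_last i))) hno
  rw [Fin.val_last] at h2
  rw [Fin.sum_univ_succ] at h1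
  generalize ∑ i : Fin s, (B i.succ).card = X at *
  generalize (B 0).card = b at *
  rw [le_max_iff]
  rcases le_total (p * k) (k + r) with hp | hp
  · left
    refine Nat.le_of_mul_le_mul_left ?_ hk
    have := Nat.mul_le_mul_right b hp
    nlinarith
  · right
    obtain ⟨e, he⟩ := Nat.exists_eq_add_of_le hp
    refine Nat.le_of_mul_le_mul_left ?_ hk
    have h3 := Nat.mul_le_mul_left e h2
    calc k * (p * b + X) = (p * k) * b + k * X := by ring
      _ = (r * b + k * (b + X)) + e * b := by rw [he]; ring
      _ ≤ s * k * ((s + 1) * k + r) + e * (s * k) := by omega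
      _ = s * k * (s * k + (k + r + e)) := by ring
      _ = k * ((p + s) * s * k) := by rw [← he]; ring

/-- The arc of length `k` starting at `x` on the cycle `Fin n`. -/
def arc (k n : ℕ) [NeZero n] (x : ℕ) : Finset (Fin n) :=
  (Finset.range k).image fun t => Fin.ofNat n (x + t)

theorem eq_of_ofNat_eq {n a b : ℕ} [NeZero n] (h : Fin.ofNat n a = Fin.ofNat n b)
    (hab : a ≤ b) (hb : b < a + n) : a = b := by
  have h1 : a ≡ b [MOD n] := congrArg Fin.val h
  have h2 := Nat.eq_zero_of_dvd_of_lt ((Nat.modEq_iff_dvd' hab).1 h1) (by omega)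
  omega

theorem card_arc {k n : ℕ} [NeZero n] (hkn : k ≤ n) (x : ℕ) : (arc k n x).card = k := by
  rw [arc, Finset.card_image_of_injOn, Finset.card_range]
  intro t ht u hu h
  have ht := Finset.mem_range.1 (Finset.mem_coe.1 ht)
  have hu := Finset.mem_range.1 (Finset.mem_coe.1 hu)
  rcases le_total t u with htu | htu
  · have := eq_of_ofNat_eq h (by omega) (by omega)
    omega
  · have := eq_of_ofNat_eq h.symm (by omega) (by omega)
    omega

theorem ArcSep.disjoint_arc {k n x y : ℕ} [NeZero n] (h : ArcSep k n x y) :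
    Disjoint (arc k n x) (arc k n y) := by
  rw [Finset.disjoint_left]
  intro a ha hb
  simp only [arc, Finset.mem_image, Finset.mem_range] at ha hb
  obtain ⟨t, ht, rfl⟩ := ha
  obtain ⟨u, hu, hut⟩ := hb
  rcases h with h | h
  · have := eq_of_ofNat_eq hut.symm (by omega) (by omega)
    omega
  · have := eq_of_ofNat_eq hut (by omega) (by omega)
    omega

theorem exists_perm_map_eq {α : Type*} [Fintype α] [DecidableEq α] {S T : Finset α}
    (h : S.card = T.card) : ∃ τ : Equiv.Perm α, S.map τ.toEmbedding = T := by
  let e : {x // x ∈ S} ≃ {x // x ∈ T} := Finset.equivOfCardEq h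
  refine ⟨e.extendSubtype, Finset.eq_of_subset_of_card_le ?_ (by rw [Finset.card_map, h])⟩
  intro y hy
  obtain ⟨x, hx, rfl⟩ := Finset.mem_map.1 hy
  exact e.extendSubtype_mem x hx

/-- The permutations mapping a given `k`-set to a given `k`-set form a fraction
`1 / C(n, k)` of all permutations. -/
theorem card_perm_map_eq_mul_choose {α : Type*} [Fintype α] [DecidableEq α] {S A : Finset α}
    (h : A.card = S.card) :
    (Finset.univ.filter fun σ : Equiv.Perm α => S.map σ.toEmbedding = A).card *
      (Fintype.card α).choose S.card = (Fintype.card α).factorial := by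
  have hconst : ∀ A' ∈ Finset.powersetCard S.card (Finset.univ : Finset α),
      (Finset.univ.filter fun σ : Equiv.Perm α => S.map σ.toEmbedding = A').card =
      (Finset.univ.filter fun σ : Equiv.Perm α => S.map σ.toEmbedding = A).card := by
    intro A' hA'
    obtain ⟨τ, hτ⟩ := exists_perm_map_eq ((Finset.mem_powersetCard.1 hA').2.trans h.symm)
    refine Finset.card_equiv (Equiv.mulLeft τ) fun σ => ?_
    have hmul : S.map (τ * σ).toEmbedding = (S.map σ.toEmbedding).map τ.toEmbedding := by
      rw [Finset.map_map]
      rfl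
    simp only [Finset.mem_filter, Finset.mem_univ, true_and, Equiv.coe_mulLeft, hmul, ← hτ]
    exact (Finset.map_injective _).eq_iff.symm
  rw [← Fintype.card_perm, ← Finset.card_univ (α := Equiv.Perm α),
    Finset.card_eq_sum_card_fiberwise (s := Finset.univ)
      (f := fun σ : Equiv.Perm α => S.map σ.toEmbedding)
      (t := Finset.powersetCard S.card (Finset.univ : Finset α))
      (fun σ _ => by simp [Finset.mem_powersetCard]),
    Finset.sum_congr rfl hconst, Finset.sum_const, Finset.card_powersetCard, smul_eq_mul,
    mul_comm, Finset.card_univ]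

/-- The starting points of the arcs that `σ` maps into `𝒜`. -/
def arcStarts {n : ℕ} [NeZero n] (k : ℕ) (𝒜 : Finset (Finset (Fin n))) (σ : Equiv.Perm (Fin n)) :
    Finset ℕ :=
  (Finset.range n).filter fun x => (arc k n x).map σ.toEmbedding ∈ 𝒜

theorem sum_card_arcStarts_mul_choose {k n : ℕ} [NeZero n] (hkn : k ≤ n)
    {𝒜 : Finset (Finset (Fin n))} (h𝒜 : ∀ A ∈ 𝒜, A.card = k) :
    (∑ σ : Equiv.Perm (Fin n), (arcStarts k 𝒜 σ).card) * n.choose k =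
      n.factorial * (n * 𝒜.card) := by
  have hx : ∀ x, (Finset.univ.filter fun σ : Equiv.Perm (Fin n) =>
      (arc k n x).map σ.toEmbedding ∈ 𝒜).card * n.choose k = 𝒜.card * n.factorial := by
    intro x
    rw [Finset.card_eq_sum_card_fiberwise (t := 𝒜)
      (f := fun σ : Equiv.Perm (Fin n) => (arc k n x).map σ.toEmbedding)
      (fun σ hσ => by simpa using hσ), Finset.sum_mul, ← smul_eq_mul, ← Finset.sum_const]
    refine Finset.sum_congr rfl fun A hA => ?_
    have key := card_perm_map_eq_mul_choose (S := arc k n x) (A := A)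
      ((h𝒜 A hA).trans (card_arc hkn x).symm)
    rw [Fintype.card_fin, card_arc hkn] at key
    rw [← key, Finset.filter_filter]
    congr 3
    ext σ
    exact ⟨fun h => h.2, fun h => ⟨h ▸ hA, h⟩⟩
  have hswap : ∑ σ : Equiv.Perm (Fin n), (arcStarts k 𝒜 σ).card =
      ∑ x ∈ Finset.range n, (Finset.univ.filter fun σ : Equiv.Perm (Fin n) =>
        (arc k n x).map σ.toEmbedding ∈ 𝒜).card := by
    simp only [arcStarts, Finset.card_filter]
    exact Finset.sum_comm
  rw [hswap, Finset.sum_mul, Finset.sum_congr rfl fun x _ => hx x, Finset.sum_const,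
    Finset.card_range, smul_eq_mul]
  ring

theorem not_hasSepTransversal_arcStarts {k n m : ℕ} [NeZero n]
    {B : Fin m → Finset (Finset (Fin n))} (hover : ¬ HasRainbowMatching B m)
    (σ : Equiv.Perm (Fin n)) : ¬ HasSepTransversal k n fun i => arcStarts k (B i) σ := by
  rintro ⟨f, hf, hsep⟩
  exact hover ⟨id, fun i => (arc k n (f i)).map σ.toEmbedding, strictMono_id,
    fun i => (Finset.mem_filter.1 (hf i)).2,
    fun i j hij => (Finset.disjoint_map _).2 (hsep i j hij).disjoint_arc⟩

/-- Theorem 1.1: for `n ≥ (s+1)k` and nested overlapping families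
`ℬ₀ ⊆ ℬ₁ ⊆ … ⊆ ℬ_s` of `k`-subsets of `[n]`, one has
`p|ℬ₀| + |ℬ₁| + … + |ℬ_s| ≤ max { s·C(n,k), (p+s)·s·C(n-1,k-1) }`. -/
theorem stmt0 (k s p n : ℕ) (hk : 0 < k) (hs : 0 < s) (hp : 0 < p)
    (hn : (s + 1) * k ≤ n)
    (B : Fin (s + 1) → Finset (Finset (Fin n)))
    (hunif : ∀ i, ∀ A ∈ B i, A.card = k)
    (hnested : ∀ i j : Fin (s + 1), i ≤ j → B i ⊆ B j)
    (hover : ¬ HasRainbowMatching B (s + 1)) :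
    p * (B 0).card + ∑ i : Fin s, (B i.succ).card ≤
      max (s * n.choose k) ((p + s) * s * (n - 1).choose (k - 1)) := by
  have hkn : k ≤ n := le_trans (Nat.le_mul_of_pos_left k s.succ_pos) hn
  have hn0 : 0 < n := hk.trans_le hkn
  have : NeZero n := ⟨hn0.ne'⟩
  have hcirc : ∀ σ : Equiv.Perm (Fin n), p * (arcStarts k (B 0) σ).card +
      ∑ i : Fin s, (arcStarts k (B i.succ) σ).card ≤ max (s * n) ((p + s) * s * k) := by
    intro σ
    refine weighted_card_le_max (B := fun i => arcStarts k (B i) σ) hk hn ?_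
      (fun i => Finset.filter_subset _ _) (not_hasSepTransversal_arcStarts hover σ)
    intro i j hij x hx
    have hx := Finset.mem_filter.1 hx
    exact Finset.mem_filter.2 ⟨hx.1, hnested i j hij hx.2⟩
  have hsum := Nat.mul_le_mul_right (n.choose k) 
    (Finset.sum_le_sum (s := Finset.univ) fun σ _ => hcirc σ)
  have hleft : (∑ σ : Equiv.Perm (Fin n), (p * (arcStarts k (B 0) σ).card +
      ∑ i : Fin s, (arcStarts k (B i.succ) σ).card)) * n.choose k =
      n.factorial * (n * (p * (B 0).card + ∑ i : Fin s, (B i.succ).card)) := by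
    rw [Finset.sum_add_distrib, ← Finset.mul_sum, Finset.sum_comm, add_mul, mul_assoc,
      sum_card_arcStarts_mul_choose hkn (hunif 0), Finset.sum_mul,
      Finset.sum_congr rfl fun i _ => sum_card_arcStarts_mul_choose hkn (hunif (Fin.succ i)),
      ← Finset.mul_sum, ← Finset.mul_sum]
    ring
  rw [hleft, Finset.sum_const, Finset.card_univ, Fintype.card_perm, Fintype.card_fin, smul_eq_mul,
    mul_assoc] at hsum
  refine Nat.le_of_mul_le_mul_left ((Nat.le_of_mul_le_mul_left hsum n.factorial_pos).trans_eq ?_)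
    hn0
  have hchoose : k * n.choose k = n * (n - 1).choose (k - 1) := by
    have := Nat.add_one_mul_choose_eq (n - 1) (k - 1)
    rw [Nat.sub_add_cancel hn0, Nat.sub_add_cancel hk] at this
    rw [this, mul_comm]
  rw [max_mul, mul_max]
  congr 1
  · ring
  · rw [mul_assoc, hchoose]
    ring
end

section
/- Let k, s, p be positive integers and let n ≥ 4k²s. Then the maximum of p·|ℬ₀| + |ℬ₁| + … + |ℬ_s| over all nested overlapping sequences ℬ₀ ⊆ ℬ₁ ⊆ … ⊆ ℬ_s of families of k-element subsets of [n] = {1,…,n} equals max{ s·C(n,k), (p+s)·( C(n,k) − C(n−s,k) ) }, where C(a,b) denotes the binomial coefficient. -/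
open Finset

/-- The families `B 0, …, B s` have pairwise disjoint representatives. -/
def HasRainbow {α : Type*} (B : ℕ → Finset (Finset α)) (s : ℕ) : Prop :=
  ∃ f : ℕ → Finset α, (∀ i ≤ s, f i ∈ B i) ∧
    ∀ i ≤ s, ∀ j ≤ s, i ≠ j → Disjoint (f i) (f j)

section Rainbow

variable {α : Type*}

lemma HasRainbow.cons {B : ℕ → Finset (Finset α)} {s : ℕ} {A : Finset α} {f : ℕ → Finset α}
    (hA : A ∈ B 0) (hf : ∀ i ≤ s, f i ∈ B (i + 1))
    (hd : ∀ i ≤ s, ∀ j ≤ s, i ≠ j → Disjoint (f i) (f j))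
    (hAf : ∀ i ≤ s, Disjoint A (f i)) : HasRainbow B (s + 1) := by
  refine ⟨fun i => Nat.casesOn i A f, ?_, ?_⟩
  · rintro (_ | i) hi
    · exact hA
    · exact hf i (by omega)
  · rintro (_ | i) hi (_ | j) hj hij
    · exact absurd rfl hij
    · exact hAf j (by omega)
    · exact (hAf i (by omega)).symm
    · exact hd i (by omega) j (by omega) (by omega)

variable [DecidableEq α]

lemma HasRainbow.snoc {B : ℕ → Finset (Finset α)} {s : ℕ} {A : Finset α} {f : ℕ → Finset α}
    (hA : A ∈ B (s + 1)) (hf : ∀ i ≤ s, f i ∈ B i)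
    (hd : ∀ i ≤ s, ∀ j ≤ s, i ≠ j → Disjoint (f i) (f j))
    (hAf : ∀ i ≤ s, Disjoint A (f i)) : HasRainbow B (s + 1) := by
  refine ⟨fun i => if i = s + 1 then A else f i, ?_, ?_⟩
  · intro i hi
    dsimp only
    split_ifs with h
    · exact h ▸ hA
    · exact hf i (by omega)
  · intro i hi j hj hij
    dsimp only
    split_ifs with h h' h'
    · omega
    · exact hAf j (by omega)
    · exact (hAf i (by omega)).symm
    · exact hd i (by omega) j (by omega) hij

lemma hasRainbow_const_cons {G : Finset (Finset α)} {s : ℕ} {A : Finset α} (hA : A ∈ G)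
    (h : HasRainbow (fun _ => {C ∈ G | Disjoint A C}) s) :
    HasRainbow (fun _ => G) (s + 1) := by
  obtain ⟨f, hf, hd⟩ := h
  exact HasRainbow.cons hA (fun i hi => (mem_filter.1 (hf i hi)).1) hd
    (fun i hi => (mem_filter.1 (hf i hi)).2)

lemma eq_empty_of_not_hasRainbow_zero {B : ℕ → Finset (Finset α)} (h : ¬ HasRainbow B 0) :
    B 0 = ∅ := by
  by_contra hne
  obtain ⟨A, hA⟩ := nonempty_iff_ne_empty.2 hne
  exact h ⟨fun _ => A, fun i hi => by simpa [Nat.le_zero.1 hi] using hA,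
    fun i hi j hj hij => by omega⟩

/-- A family of `k`-sets without `s + 1` pairwise disjoint members has a cover of size `s * k`. -/
lemma exists_cover {k : ℕ} (s : ℕ) (G : Finset (Finset α)) (hG : ∀ A ∈ G, A.card = k)
    (h : ¬ HasRainbow (fun _ => G) s) :
    ∃ T : Finset α, T.card ≤ s * k ∧ ∀ A ∈ G, ¬ Disjoint T A := by
  induction s generalizing G with
  | zero =>
    have hG0 : G = ∅ := eq_empty_of_not_hasRainbow_zero h
    exact ⟨∅, by simp, by simp [hG0]⟩
  | succ s ih =>
    rcases G.eq_empty_or_nonempty with rfl | ⟨A, hA⟩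
    · exact ⟨∅, by simp, by simp⟩
    obtain ⟨T, hT, hTA⟩ := ih {C ∈ G | Disjoint A C} (fun C hC => hG C (mem_filter.1 hC).1)
      (fun hr => h (hasRainbow_const_cons hA hr))
    refine ⟨T ∪ A, (card_union_le _ _).trans ?_, fun C hC hd => ?_⟩
    · rw [hG A hA, add_mul, one_mul]
      omega
    · rw [disjoint_union_left] at hd
      exact hTA C (mem_filter.2 ⟨hC, hd.2⟩) hd.1

lemma card_filter_disjoint_powersetCard {W C : Finset α} {r : ℕ} (hC : C ∈ powersetCard r W) :
    {A ∈ powersetCard r W | Disjoint A C}.card = (W.card - r).choose r := by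
  rw [mem_powersetCard] at hC
  have : {A ∈ powersetCard r W | Disjoint A C} = powersetCard r (W \ C) := by
    ext A
    simp only [mem_filter, mem_powersetCard, subset_sdiff]
    tauto
  rw [this, card_powersetCard, card_sdiff_of_subset hC.1, hC.2]

/-- Kleitman's averaging bound. -/
lemma mul_card_le_of_not_hasRainbow {r : ℕ} (m s : ℕ) (W : Finset α) (G : Finset (Finset α))
    (hG : G ⊆ powersetCard r W) (hm : m * r ≤ W.card) (h : ¬ HasRainbow (fun _ => G) s) :
    m * G.card ≤ s * W.card.choose r := by
  induction m generalizing s W G with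
  | zero => simp
  | succ m ih =>
    cases s with
    | zero => simp [eq_empty_of_not_hasRainbow_zero h]
    | succ s =>
    rcases Nat.eq_zero_or_pos m with rfl | hmpos
    · have := card_le_card hG
      rw [card_powersetCard] at this
      nlinarith
    have hpos : 0 < (W.card - r).choose r := by
      apply Nat.choose_pos
      have : (1 + 1) * r ≤ (m + 1) * r := Nat.mul_le_mul_right r (by omega)
      omega
    have key : ∀ A ∈ powersetCard r W,
        m * {C ∈ G | Disjoint A C}.card + (if A ∈ G then (W.card - r).choose r else 0)
          ≤ (s + 1) * (W.card - r).choose r := by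
      intro A hA
      have hA' := mem_powersetCard.1 hA
      have hcard : (W \ A).card = W.card - r := by rw [card_sdiff_of_subset hA'.1, hA'.2]
      have hsub : {C ∈ G | Disjoint A C} ⊆ powersetCard r (W \ A) := by
        intro C hC
        obtain ⟨hC, hd⟩ := mem_filter.1 hC
        have := mem_powersetCard.1 (hG hC)
        exact mem_powersetCard.2 ⟨subset_sdiff.2 ⟨this.1, hd.symm⟩, this.2⟩
      have hm' : m * r ≤ (W \ A).card := by
        rw [hcard]
        rw [add_mul, one_mul] at hm
        omega
      split_ifs with hAG
      · have := ih s (W \ A) _ hsub hm' (fun hr => h (hasRainbow_const_cons hAG hr))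
        rw [hcard] at this
        rw [add_mul, one_mul]
        omega
      · have := ih (s + 1) (W \ A) _ hsub hm' (fun ⟨f, hf, hd⟩ =>
          h ⟨f, fun i hi => (mem_filter.1 (hf i hi)).1, hd⟩)
        rw [hcard] at this
        omega
    have hsum := sum_le_sum key
    rw [sum_add_distrib, ← mul_sum, sum_const, card_powersetCard, ← sum_filter,
      filter_mem_eq_inter, inter_eq_right.2 hG, sum_const, smul_eq_mul, smul_eq_mul] at hsum
    have hdc : ∑ A ∈ powersetCard r W, {C ∈ G | Disjoint A C}.card
        = G.card * (W.card - r).choose r := by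
      refine (sum_card_bipartiteAbove_eq_sum_card_bipartiteBelow _).trans ?_
      unfold bipartiteBelow
      rw [sum_congr rfl (fun C hC => card_filter_disjoint_powersetCard (hG hC))]
      simp
    rw [hdc] at hsum
    refine Nat.le_of_mul_le_mul_right ?_ hpos
    linarith

/-- Sets of size `k` containing a fixed set are few. -/
lemma card_filter_superset_powersetCard_le (V Z : Finset α) (k : ℕ) (hZ : Z ⊆ V) :
    {A ∈ powersetCard k V | Z ⊆ A}.card ≤ (V.card - Z.card).choose (k - Z.card) := by
  rw [← card_sdiff_of_subset hZ, ← card_powersetCard]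
  refine card_le_card_of_injOn (fun A => A \ Z) ?_ ?_
  · intro A hA
    simp only [coe_filter, mem_powersetCard, Set.mem_ofPred_eq] at hA
    simp only [mem_coe, mem_powersetCard]
    exact ⟨sdiff_subset_sdiff hA.1.1 le_rfl, by rw [card_sdiff_of_subset hA.2, hA.1.2]⟩
  · intro A hA C hC h
    simp only [coe_filter, mem_powersetCard, Set.mem_ofPred_eq] at hA hC
    dsimp only at h
    rw [← sdiff_union_of_subset hA.2, ← sdiff_union_of_subset hC.2, h]

lemma card_filter_mem_powersetCard_le {V : Finset α} {v : α} (hv : v ∈ V) (k : ℕ) :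
    {A ∈ powersetCard k V | v ∈ A}.card ≤ (V.card - 1).choose (k - 1) := by
  simpa using card_filter_superset_powersetCard_le V {v} k (by simpa using hv)

/-- A large family has a member avoiding a small set. -/
lemma exists_disjoint_of_lt_card {V T : Finset α} {k : ℕ} {F : Finset (Finset α)}
    (hF : F ⊆ powersetCard k V) (hT : T ⊆ V)
    (h : T.card * (V.card - 1).choose (k - 1) < F.card) : ∃ A ∈ F, Disjoint A T := by
  by_contra! hcon
  have hsub : F ⊆ T.biUnion (fun u => {A ∈ powersetCard k V | u ∈ A}) := by
    intro A hA
    obtain ⟨u, hu, huT⟩ := not_disjoint_iff.1 (hcon A hA)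
    exact mem_biUnion.2 ⟨u, huT, mem_filter.2 ⟨hF hA, hu⟩⟩
  have := (card_le_card hsub).trans (card_biUnion_le_card_mul _ _ _
    (fun u hu => card_filter_mem_powersetCard_le (hT hu) k))
  omega

lemma exists_mem_disjoint_of_lt_card {V T : Finset α} {k : ℕ} {v : α} (hv : v ∈ V)
    (hvT : v ∉ T) {F : Finset (Finset α)} (hF : F ⊆ powersetCard k V) (hT : T ⊆ V)
    (h : T.card * (V.card - 2).choose (k - 2) < {A ∈ F | v ∈ A}.card) :
    ∃ A ∈ F, v ∈ A ∧ Disjoint A T := by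
  by_contra! hcon
  have hsub : {A ∈ F | v ∈ A} ⊆ T.biUnion (fun u => {A ∈ powersetCard k V | {u, v} ⊆ A}) := by
    intro A hA
    obtain ⟨hA, hvA⟩ := mem_filter.1 hA
    obtain ⟨u, hu, huT⟩ := not_disjoint_iff.1 (hcon A hA hvA)
    exact mem_biUnion.2 ⟨u, huT, mem_filter.2 ⟨hF hA, by simp [insert_subset_iff, hu, hvA]⟩⟩
  have := (card_le_card hsub).trans (card_biUnion_le_card_mul _ _
    ((V.card - 2).choose (k - 2)) (fun u hu => by
      have huv : ({u, v} : Finset α).card = 2 :=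
        card_pair (fun h => hvT (h ▸ hu))
      have := card_filter_superset_powersetCard_le V {u, v} k
        (by simp [insert_subset_iff, hv, hT hu])
      rwa [huv] at this))
  omega

end Rainbow

section Shift

variable {α : Type*} [DecidableEq α]

/-- Exchange `x` and `y` in a set. -/
def swapSet (x y : α) (A : Finset α) : Finset α := A.map (Equiv.swap x y).toEmbedding

lemma mem_swapSet {x y z : α} {A : Finset α} : z ∈ swapSet x y A ↔ Equiv.swap x y z ∈ A := by
  rw [swapSet, mem_map_equiv, Equiv.symm_swap]

lemma swapSet_swapSet (x y : α) (A : Finset α) : swapSet x y (swapSet x y A) = A := by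
  ext z
  simp [mem_swapSet]

lemma card_swapSet (x y : α) (A : Finset α) : (swapSet x y A).card = A.card := card_map _

lemma swapSet_eq_self {x y : α} {A : Finset α} (hx : x ∉ A) (hy : y ∉ A) :
    swapSet x y A = A := by
  ext z
  rw [mem_swapSet, Equiv.swap_apply_def]
  split_ifs with h h' <;> simp_all

lemma swapSet_insert {x y : α} {C : Finset α} (hx : x ∉ C) (hy : y ∉ C) :
    swapSet x y (insert y C) = insert x C := by
  have : swapSet x y C = C := swapSet_eq_self hx hy
  rw [swapSet] at this ⊢
  rw [map_insert, this]
  simp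

lemma swapSet_subset {x y : α} {A V : Finset α} (hx : x ∈ V) (hy : y ∈ V) (hA : A ⊆ V) :
    swapSet x y A ⊆ V := by
  intro z hz
  rw [mem_swapSet, Equiv.swap_apply_def] at hz
  split_ifs at hz with h h'
  · exact h ▸ hx
  · exact h' ▸ hy
  · exact hA hz

/-- Replace `y` by `x` in `A` unless this gives a set that is already in `F`. -/
def shiftMap (x y : α) (F : Finset (Finset α)) (A : Finset α) : Finset α :=
  if y ∈ A ∧ x ∉ A ∧ swapSet x y A ∉ F then swapSet x y A else A

/-- The shift of a family, replacing `y` by `x`. -/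
def shift (x y : α) (F : Finset (Finset α)) : Finset (Finset α) := F.image (shiftMap x y F)

lemma shiftMap_injOn (x y : α) (F : Finset (Finset α)) : Set.InjOn (shiftMap x y F) F := by
  intro A hA C hC h
  rw [mem_coe] at hA hC
  unfold shiftMap at h
  split_ifs at h with h1 h2 h2
  · rw [← swapSet_swapSet x y A, h, swapSet_swapSet]
  · exact absurd (h ▸ hC) h1.2.2
  · exact absurd (h ▸ hA) h2.2.2
  · exact h

lemma card_shift (x y : α) (F : Finset (Finset α)) : (shift x y F).card = F.card :=
  card_image_of_injOn (shiftMap_injOn x y F)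

lemma mem_of_mem_shift {x y : α} {F : Finset (Finset α)} {C : Finset α} (hC : C ∈ shift x y F)
    (hx : x ∉ C) : C ∈ F ∧ (y ∈ C → swapSet x y C ∈ F) := by
  obtain ⟨A, hA, rfl⟩ := mem_image.1 hC
  unfold shiftMap at hx ⊢
  split_ifs at hx ⊢ with h
  · exact absurd (mem_swapSet.2 (by simpa using h.1)) hx
  · exact ⟨hA, fun hy => by by_contra hcon; exact h ⟨hy, hx, hcon⟩⟩

lemma swapSet_mem_of_mem_shift {x y : α} {F : Finset (Finset α)} {C : Finset α}
    (hC : C ∈ shift x y F) (hCF : C ∉ F) : x ∈ C ∧ swapSet x y C ∈ F := by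
  obtain ⟨A, hA, rfl⟩ := mem_image.1 hC
  unfold shiftMap at hCF ⊢
  split_ifs at hCF ⊢ with h
  · exact ⟨mem_swapSet.2 (by simpa using h.1), by rwa [swapSet_swapSet]⟩
  · exact absurd hA hCF

lemma shift_mono (x y : α) {F G : Finset (Finset α)} (h : F ⊆ G) :
    shift x y F ⊆ shift x y G := by
  intro C hC
  obtain ⟨A, hA, rfl⟩ := mem_image.1 hC
  by_cases hm : y ∈ A ∧ x ∉ A ∧ swapSet x y A ∉ F
  · rw [shiftMap, if_pos hm]
    by_cases hG : swapSet x y A ∈ G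
    · refine mem_image.2 ⟨_, hG, if_neg fun hcon => hcon.2.1 ?_⟩
      exact mem_swapSet.2 (by simpa using hm.1)
    · exact mem_image.2 ⟨A, h hA, if_pos ⟨hm.1, hm.2.1, hG⟩⟩
  · rw [shiftMap, if_neg hm]
    exact mem_image.2 ⟨A, h hA, if_neg fun hcon => hm ⟨hcon.1, hcon.2.1, fun h' => hcon.2.2 (h h')⟩⟩

lemma shift_subset_powersetCard {x y : α} {F : Finset (Finset α)} {V : Finset α} {k : ℕ}
    (hx : x ∈ V) (hy : y ∈ V) (hF : F ⊆ powersetCard k V) : shift x y F ⊆ powersetCard k V := by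
  intro C hC
  by_cases hCF : C ∈ F
  · exact hF hCF
  · have := mem_powersetCard.1 (hF (swapSet_mem_of_mem_shift hC hCF).2)
    rw [card_swapSet] at this
    refine mem_powersetCard.2 ⟨?_, this.2⟩
    rw [← swapSet_swapSet x y C]
    exact swapSet_subset hx hy this.1

lemma HasRainbow.of_shift {x y : α} {B : ℕ → Finset (Finset α)} {s : ℕ}
    (h : HasRainbow (fun i => shift x y (B i)) s) : HasRainbow B s := by
  obtain ⟨f, hf, hd⟩ := h
  by_cases hall : ∀ i ≤ s, f i ∈ B i
  · exact ⟨f, hall, hd⟩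
  push Not at hall
  obtain ⟨l, hl, hlB⟩ := hall
  obtain ⟨hxl, hswap⟩ := swapSet_mem_of_mem_shift (hf l hl) hlB
  refine ⟨fun i => swapSet x y (f i), fun i hi => ?_, fun i hi j hj hij => ?_⟩
  · by_cases hil : i = l
    · exact hil ▸ hswap
    have hxi : x ∉ f i := fun hxi => disjoint_left.1 (hd i hi l hl hil) hxi hxl
    obtain ⟨hiB, hiy⟩ := mem_of_mem_shift (hf i hi) hxi
    by_cases hyi : y ∈ f i
    · exact hiy hyi
    · dsimp only
      rwa [swapSet_eq_self hxi hyi]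
  · exact (disjoint_map _).2 (hd i hi j hj hij)

lemma card_inter_swapSet {x y : α} {S A : Finset α} (hx : x ∈ S) (hy : y ∉ S) (hyA : y ∈ A)
    (hxA : x ∉ A) : (A ∩ S).card + 1 = (swapSet x y A ∩ S).card := by
  have hC : y ∉ A.erase y := by simp
  have hC' : x ∉ A.erase y := fun h => hxA (mem_of_mem_erase h)
  rw [← insert_erase hyA, swapSet_insert hC' hC, insert_inter_of_mem hx,
    insert_inter_of_notMem hy, card_insert_of_notMem]
  exact fun h => hC' (mem_inter.1 h).1

lemma sum_card_inter_lt_shift {x y : α} {S : Finset α} {F : Finset (Finset α)} (hx : x ∈ S)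
    (hy : y ∉ S) {A : Finset α} (hA : A ∈ F) (hyA : y ∈ A) (hxA : x ∉ A)
    (hAF : swapSet x y A ∉ F) :
    ∑ C ∈ F, (C ∩ S).card < ∑ C ∈ shift x y F, (C ∩ S).card := by
  rw [shift, sum_image (shiftMap_injOn x y F)]
  refine sum_lt_sum (fun C _ => ?_) ⟨A, hA, ?_⟩
  · unfold shiftMap
    split_ifs with h
    · have := card_inter_swapSet hx hy h.1 h.2.1
      omega
    · exact le_rfl
  · rw [shiftMap, if_pos ⟨hyA, hxA, hAF⟩, ← card_inter_swapSet hx hy hyA hxA]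
    omega

/-- Nested families without a rainbow matching may be assumed to be stable under shifts
into a fixed set `S`. -/
lemma exists_shifted {V S : Finset α} (hS : S ⊆ V) {k s : ℕ} (B : ℕ → Finset (Finset α))
    (hB : ∀ i, B i ⊆ powersetCard k V) (hmono : Monotone B) (hr : ¬ HasRainbow B s) :
    ∃ B' : ℕ → Finset (Finset α), (∀ i, (B' i).card = (B i).card) ∧
      (∀ i, B' i ⊆ powersetCard k V) ∧ Monotone B' ∧ ¬ HasRainbow B' s ∧
      ∀ A ∈ B' 0, ∀ x ∈ S, ∀ y ∈ V, y ∉ S → y ∈ A → x ∉ A → swapSet x y A ∈ B' 0 := by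
  induction hd : (B 0).card * S.card - ∑ C ∈ B 0, (C ∩ S).card using Nat.strong_induction_on
    generalizing B with
  | _ d ih =>
  by_cases hst : ∀ A ∈ B 0, ∀ x ∈ S, ∀ y ∈ V, y ∉ S → y ∈ A → x ∉ A → swapSet x y A ∈ B 0
  · exact ⟨B, fun _ => rfl, hB, hmono, hr, hst⟩
  push Not at hst
  obtain ⟨A, hA, x, hx, y, hyV, hyS, hyA, hxA, hAF⟩ := hst
  have hlt := sum_card_inter_lt_shift hx hyS hA hyA hxA hAF
  have hle : ∑ C ∈ shift x y (B 0), (C ∩ S).card ≤ (B 0).card * S.card := by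
    rw [← card_shift x y (B 0), ← smul_eq_mul]
    exact sum_le_card_nsmul _ _ _ (fun C _ => card_le_card inter_subset_right)
  obtain ⟨B', h1, h2⟩ := ih _ (by rw [← hd, card_shift]; omega) (fun i => shift x y (B i))
    (fun i => shift_subset_powersetCard (hS hx) hyV (hB i))
    (fun i j hij => shift_mono x y (hmono hij)) (fun h => hr h.of_shift) rfl
  exact ⟨B', fun i => (h1 i).trans (card_shift x y (B i)), h2⟩

end Shift

section Binomial

lemma mul_choose_le_of_le {k q M : ℕ} (h : M + 1 ≤ k * (q + 1)) :
    (q + 1) * M.choose k ≤ q * (M + 1).choose k := by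
  have hid := Nat.choose_mul_succ_eq M k
  refine Nat.le_of_mul_le_mul_right ?_ (Nat.succ_pos M)
  have : (q + 1) * (M + 1 - k) ≤ q * (M + 1) := by
    rw [Nat.mul_sub, Nat.sub_le_iff_le_add]
    linarith
  calc (q + 1) * M.choose k * (M + 1) = (q + 1) * (M + 1 - k) * (M + 1).choose k := by
        rw [mul_assoc, hid]; ring
    _ ≤ q * (M + 1) * (M + 1).choose k := Nat.mul_le_mul_right _ this
    _ = q * (M + 1).choose k * (M + 1) := by ring

lemma mul_choose_le_of_ge {k q M : ℕ} (h : k * (q + 1) ≤ M + 1) :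
    q * (M + 1).choose k ≤ (q + 1) * M.choose k := by
  have hid := Nat.choose_mul_succ_eq M k
  refine Nat.le_of_mul_le_mul_right ?_ (Nat.succ_pos M)
  have : q * (M + 1) ≤ (q + 1) * (M + 1 - k) := by
    rw [Nat.mul_sub]
    apply Nat.le_sub_of_add_le
    linarith
  calc q * (M + 1).choose k * (M + 1) = q * (M + 1) * (M + 1).choose k := by ring
    _ ≤ (q + 1) * (M + 1 - k) * (M + 1).choose k := Nat.mul_le_mul_right _ this
    _ = (q + 1) * M.choose k * (M + 1) := by
        rw [mul_assoc (q + 1) (M.choose k), hid]; ring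

/-- The sequence `(p + i) * (n - i).choose k` is unimodal, so it is minimised at an end point. -/
lemma min_le_mul_choose {n k p s i : ℕ} (hi : i ≤ s) (hs : s ≤ n) :
    min (p * n.choose k) ((p + s) * (n - s).choose k) ≤ (p + i) * (n - i).choose k := by
  rcases le_total (n - i) (k * (p + i + 1)) with h | h
  · refine (min_le_right _ _).trans ?_
    induction s, hi using Nat.le_induction with
    | base => exact le_rfl
    | succ j hj ih =>
      refine le_trans ?_ (ih (by omega))
      obtain ⟨M, hM⟩ : ∃ M, n - j = M + 1 := ⟨n - j - 1, by omega⟩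
      rw [show n - (j + 1) = M by omega, hM, ← add_assoc]
      apply mul_choose_le_of_le
      calc M + 1 ≤ n - i := by omega
        _ ≤ k * (p + i + 1) := h
        _ ≤ k * (p + j + 1) := Nat.mul_le_mul_left _ (by omega)
  · refine (min_le_left _ _).trans ?_
    have hin : i ≤ n := hi.trans hs
    clear hi hs
    induction i with
    | zero => simp
    | succ j ih =>
      obtain ⟨M, hM⟩ : ∃ M, n - j = M + 1 := ⟨n - j - 1, by omega⟩
      have hk : k * (p + j + 1) ≤ k * (p + (j + 1) + 1) := Nat.mul_le_mul_left _ (by omega)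
      refine (ih (by omega) (by omega)).trans ?_
      rw [show n - (j + 1) = M by omega, hM, ← add_assoc]
      exact mul_choose_le_of_ge (by omega)

lemma add_mul_sub_choose_le_max {n k p s i : ℕ} (hi : i ≤ s) (hs : s ≤ n) :
    (p + i) * (n.choose k - (n - i).choose k) + (s - i) * n.choose k ≤
      max (s * n.choose k) ((p + s) * (n.choose k - (n - s).choose k)) := by
  have h := min_le_mul_choose (k := k) (p := p) hi hs
  obtain ⟨a, ha⟩ := Nat.exists_eq_add_of_le (Nat.choose_le_choose k (Nat.sub_le n i))
  obtain ⟨b, hb⟩ := Nat.exists_eq_add_of_le (Nat.choose_le_choose k (Nat.sub_le n s))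
  obtain ⟨d, rfl⟩ := Nat.exists_eq_add_of_le hi
  rw [show n.choose k - (n - i).choose k = a by omega,
    show n.choose k - (n - (i + d)).choose k = b by omega, Nat.add_sub_cancel_left]
  generalize n.choose k = N at *
  generalize (n - i).choose k = ci at *
  generalize (n - (i + d)).choose k = cs at *
  rw [le_max_iff]
  rcases min_le_iff.1 h with h | h
  · left
    subst ha
    nlinarith
  · right
    have : (p + (i + d)) * (cs + b) = (p + (i + d)) * N := by rw [hb]
    have : (p + i) * (ci + a) = (p + i) * N := by rw [ha]
    nlinarith

lemma choose_add_le (m s k : ℕ) :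
    (m + s).choose (k + 1) ≤ m.choose (k + 1) + s * (m + s - 1).choose k := by
  induction s with
  | zero => simp
  | succ s ih =>
    have h1 : (m + s - 1).choose k ≤ (m + s).choose k := Nat.choose_le_choose k (by omega)
    have h2 := Nat.mul_le_mul_left s h1
    rw [← add_assoc, Nat.choose_succ_succ' (m + s), Nat.add_sub_cancel, add_mul, one_mul]
    omega

lemma le_choose_add (m s k : ℕ) :
    m.choose (k + 1) + s * m.choose k ≤ (m + s).choose (k + 1) := by
  induction s with
  | zero => simp
  | succ s ih =>
    have h1 : m.choose k ≤ (m + s).choose k := Nat.choose_le_choose k (by omega)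
    rw [← add_assoc, Nat.choose_succ_succ' (m + s), add_mul, one_mul]
    omega

lemma four_mul_choose_pred_le {n k s : ℕ} (hk : 1 ≤ k) (hn : 4 * k ^ 2 * s ≤ n) :
    4 * (s * k * (n - 1).choose (k - 1)) ≤ n.choose k := by
  obtain ⟨k, rfl⟩ := Nat.exists_eq_add_of_le' hk
  rcases Nat.eq_zero_or_pos s with rfl | hs
  · simp
  obtain ⟨n, rfl⟩ : ∃ m, n = m + 1 := ⟨n - 1, by
    have : 0 < 4 * (k + 1) ^ 2 * s := by positivity
    omega⟩
  have hid := Nat.add_one_mul_choose_eq n k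
  simp only [Nat.add_sub_cancel]
  refine Nat.le_of_mul_le_mul_right ?_ (Nat.succ_pos k)
  rw [Nat.succ_eq_add_one, ← hid]
  calc _ = 4 * (k + 1) ^ 2 * s * n.choose k := by ring
    _ ≤ _ := Nat.mul_le_mul_right _ hn

lemma four_mul_choose_sub_two_le {n k s : ℕ} (hk : 2 ≤ k) (hs : 1 ≤ s)
    (hn : 4 * k ^ 2 * s ≤ n) :
    4 * (s * k * (n - 2).choose (k - 2)) ≤ (n - 1).choose (k - 1) := by
  obtain ⟨k, rfl⟩ := Nat.exists_eq_add_of_le' hk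
  obtain ⟨s, rfl⟩ := Nat.exists_eq_add_of_le' hs
  obtain ⟨n, rfl⟩ : ∃ m, n = m + 2 := ⟨n - 2, by
    have : 2 ≤ 4 * (k + 2) ^ 2 * (s + 1) := by nlinarith
    omega⟩
  have hid := Nat.add_one_mul_choose_eq n k
  simp only [Nat.add_sub_cancel, show n + 2 - 1 = n + 1 by omega,
    show k + 2 - 1 = k + 1 by omega]
  refine Nat.le_of_mul_le_mul_right ?_ (Nat.succ_pos k)
  rw [Nat.succ_eq_add_one, ← hid]
  calc _ = 4 * (s + 1) * (k + 2) * (k + 1) * n.choose k := by ring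
    _ ≤ _ := Nat.mul_le_mul_right _ (by nlinarith)

lemma three_mul_choose_pred_le {n k s : ℕ} (hk : 2 ≤ k) (hs : 1 ≤ s)
    (hn : 4 * k ^ 2 * s ≤ n) :
    3 * (s * (n - 1).choose (k - 1)) ≤ 4 * (n.choose k - (n - s).choose k) := by
  have hD := four_mul_choose_sub_two_le hk hs hn
  obtain ⟨k, rfl⟩ := Nat.exists_eq_add_of_le' hk
  obtain ⟨s, rfl⟩ := Nat.exists_eq_add_of_le' hs
  obtain ⟨m, rfl⟩ : ∃ m, n = m + (s + 1) := ⟨n - (s + 1), by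
    have : s + 1 ≤ 4 * (k + 2) ^ 2 * (s + 1) := Nat.le_mul_of_pos_left _ (by positivity)
    omega⟩
  have h1 := le_choose_add m (s + 1) (k + 1)
  have h2 := choose_add_le m s k
  simp only [Nat.add_sub_cancel, show m + (s + 1) - 1 = m + s by omega,
    show m + (s + 1) - 2 = m + s - 1 by omega, show k + 2 - 1 = k + 1 by omega] at *
  rw [show k + 1 + 1 = k + 2 by ring] at h1
  generalize (m + s).choose (k + 1) = N1 at *
  generalize (m + s - 1).choose k = D at *
  generalize m.choose (k + 1) = c at *
  have h3 : 3 * N1 ≤ 4 * c := by nlinarith [Nat.zero_le (s * k * D), Nat.zero_le (k * D)]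
  have h4 : 3 * ((s + 1) * N1) ≤ 4 * ((s + 1) * c) := by nlinarith
  omega

end Binomial

section Main

variable {α : Type*} [DecidableEq α]

lemma card_biUnion_range_le {f : ℕ → Finset α} {s k : ℕ} (hf : ∀ i ≤ s, (f i).card = k) :
    ((range (s + 1)).biUnion f).card ≤ (s + 1) * k := by
  refine (card_biUnion_le_card_mul _ _ k fun i hi => ?_).trans (by simp)
  exact (hf i (Nat.lt_succ_iff.1 (mem_range.1 hi))).le

/-- The members of a shift-stable family that avoid `S` and contain `v` are few. -/
lemma card_filter_mem_avoiding_le {V S : Finset α} {k s : ℕ} (hk : 2 ≤ k) (hs : 1 ≤ s)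
    (hn : 4 * k ^ 2 * s ≤ V.card) (hS : S ⊆ V) (hSc : S.card = s) {B : ℕ → Finset (Finset α)}
    (hB : B 0 ⊆ powersetCard k V) (hmono : Monotone B) (hr : ¬ HasRainbow B s)
    (hst : ∀ A ∈ B 0, ∀ x ∈ S, ∀ y ∈ V, y ∉ S → y ∈ A → x ∉ A → swapSet x y A ∈ B 0) (v : α) :
    4 * (k * {A ∈ {A ∈ B 0 | Disjoint A S} | v ∈ A}.card) ≤ (V.card - 1).choose (k - 1) := by
  set F := {A ∈ {A ∈ B 0 | Disjoint A S} | v ∈ A} with hF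
  rcases F.eq_empty_or_nonempty with h0 | ⟨A₀, hA₀⟩
  · simp [h0]
  have hmem : ∀ A ∈ F, A ∈ B 0 ∧ Disjoint A S ∧ v ∈ A ∧ A ⊆ V ∧ A.card = k := by
    intro A hA
    simp only [hF, mem_filter] at hA
    have := mem_powersetCard.1 (hB hA.1.1)
    exact ⟨hA.1.1, hA.1.2, hA.2, this⟩
  obtain ⟨-, hA₀S, hvA₀, hA₀V, -⟩ := hmem A₀ hA₀
  have hvV : v ∈ V := hA₀V hvA₀
  have hvS : v ∉ S := disjoint_left.1 hA₀S hvA₀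
  set G := F.image (fun A => A.erase v) with hG
  have hGcard : G.card = F.card := by
    refine card_image_of_injOn fun A hA C hC h => ?_
    rw [← insert_erase (hmem A hA).2.2.1, h, insert_erase (hmem C hC).2.2.1]
  have hGsub : G ⊆ powersetCard (k - 1) ((V \ S).erase v) := by
    intro C hC
    obtain ⟨A, hA, rfl⟩ := mem_image.1 hC
    obtain ⟨-, h2, h3, h4, h5⟩ := hmem A hA
    exact mem_powersetCard.2 ⟨erase_subset_erase _ (subset_sdiff.2 ⟨h4, h2⟩),
      by rw [card_erase_of_mem h3, h5]⟩
  have hGmem : ∀ C ∈ G, insert v C ∈ B 0 ∧ v ∉ C ∧ Disjoint C S := by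
    intro C hC
    obtain ⟨A, hA, rfl⟩ := mem_image.1 hC
    obtain ⟨h1, h2, h3, -⟩ := hmem A hA
    exact ⟨by rwa [insert_erase h3], by simp, h2.mono_left (erase_subset _ _)⟩
  have hGr : ¬ HasRainbow (fun _ => G) s := by
    rintro ⟨f, hf, hd⟩
    apply hr
    let e := S.equivFinOfCardEq hSc
    let x : ℕ → α := fun i => if h : i < s then e.symm ⟨i, h⟩ else v
    have hxS : ∀ i < s, x i ∈ S := fun i hi => by simp only [x, dif_pos hi]; exact (e.symm _).2
    have hxv : x s = v := by simp [x]
    have hxinj : ∀ i ≤ s, ∀ j ≤ s, i ≠ j → x i ≠ x j := by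
      intro i hi j hj hij hxx
      rcases hi.lt_or_eq with hi | rfl <;> rcases hj.lt_or_eq with hj | rfl
      · simp only [x, dif_pos hi, dif_pos hj] at hxx
        have := e.symm.injective (Subtype.ext hxx)
        exact hij (Fin.mk.inj_iff.1 this)
      · exact hvS (hxv ▸ hxx ▸ hxS i hi)
      · exact hvS (hxv ▸ hxx ▸ hxS j hj)
      · exact hij rfl
    have hxf : ∀ i ≤ s, ∀ j ≤ s, x i ∉ f j := by
      intro i hi j hj
      obtain ⟨-, h2, h3⟩ := hGmem _ (hf j hj)
      rcases hi.lt_or_eq with hi | rfl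
      · exact disjoint_right.1 h3 (hxS i hi)
      · rwa [hxv]
    refine ⟨fun i => insert (x i) (f i), fun i hi => hmono (Nat.zero_le i) ?_,
      fun i hi j hj hij => ?_⟩
    · obtain ⟨h1, h2, h3⟩ := hGmem _ (hf i hi)
      rcases hi.lt_or_eq with hi' | rfl
      · dsimp only
        rw [← swapSet_insert (hxf i hi i hi) h2]
        refine hst _ h1 _ (hxS i hi') v hvV hvS (mem_insert_self _ _) ?_
        rw [mem_insert, not_or]
        exact ⟨fun h => hvS (h ▸ hxS i hi'), hxf i hi i hi⟩
      · dsimp only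
        rwa [hxv]
    · rw [disjoint_insert_left, disjoint_insert_right, mem_insert, not_or]
      exact ⟨⟨hxinj i hi j hj hij, hxf i hi j hj⟩, hxf j hj i hi, hd i hi j hj hij⟩
  have hW : ((V \ S).erase v).card = V.card - s - 1 := by
    rw [card_erase_of_mem (mem_sdiff.2 ⟨hvV, hvS⟩), card_sdiff_of_subset hS, hSc]
  have hmul := mul_card_le_of_not_hasRainbow (4 * s * k) s _ G hGsub (by
    rw [hW]
    obtain ⟨k, rfl⟩ := Nat.exists_eq_add_of_le' hk
    simp only [show k + 2 - 1 = k + 1 by omega]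
    rw [Nat.sub_sub]
    apply Nat.le_sub_of_add_le
    refine le_trans ?_ hn
    nlinarith) hGr
  rw [hGcard, hW] at hmul
  have hch : (V.card - s - 1).choose (k - 1) ≤ (V.card - 1).choose (k - 1) :=
    Nat.choose_le_choose _ (by omega)
  refine Nat.le_of_mul_le_mul_left (le_trans (le_of_eq ?_) (hmul.trans
    (Nat.mul_le_mul_left s hch))) hs
  ring

/-- A shift-stable family whose degrees in `S` are small is itself small. -/
lemma two_mul_card_le {V S : Finset α} {k s : ℕ} (hk : 2 ≤ k) (hs : 1 ≤ s)
    (hn : 4 * k ^ 2 * s ≤ V.card) (hS : S ⊆ V) (hSc : S.card = s) {B : ℕ → Finset (Finset α)}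
    (hB : B 0 ⊆ powersetCard k V) (hmono : Monotone B) (hr : ¬ HasRainbow B s)
    (hst : ∀ A ∈ B 0, ∀ x ∈ S, ∀ y ∈ V, y ∉ S → y ∈ A → x ∉ A → swapSet x y A ∈ B 0)
    (hdeg : ∀ v ∈ S, {A ∈ B 0 | v ∈ A}.card ≤ s * k * (V.card - 2).choose (k - 2)) :
    2 * (B 0).card ≤ s * (V.card - 1).choose (k - 1) := by
  have hD := four_mul_choose_sub_two_le hk hs hn
  have hhit : 4 * {A ∈ B 0 | ¬ Disjoint A S}.card ≤ s * (V.card - 1).choose (k - 1) := by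
    have hsub : {A ∈ B 0 | ¬ Disjoint A S} ⊆ S.biUnion (fun v => {A ∈ B 0 | v ∈ A}) := by
      intro A hA
      obtain ⟨hA, hnd⟩ := mem_filter.1 hA
      obtain ⟨u, hu, huS⟩ := not_disjoint_iff.1 hnd
      exact mem_biUnion.2 ⟨u, huS, mem_filter.2 ⟨hA, hu⟩⟩
    have := (card_le_card hsub).trans (card_biUnion_le_card_mul _ _ _ hdeg)
    rw [hSc] at this
    nlinarith [Nat.mul_le_mul_left s hD]
  have havoid : 4 * {A ∈ B 0 | Disjoint A S}.card ≤ s * (V.card - 1).choose (k - 1) := by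
    set F := {A ∈ B 0 | Disjoint A S} with hF
    obtain ⟨T, hT, hTA⟩ := exists_cover (k := k) s F
      (fun A hA => (mem_powersetCard.1 (hB (mem_filter.1 hA).1)).2)
      (fun ⟨f, hf, hd⟩ => hr ⟨f, fun i hi =>
        hmono (Nat.zero_le i) (mem_filter.1 (hf i hi)).1, hd⟩)
    have hsub : F ⊆ T.biUnion (fun v => {A ∈ F | v ∈ A}) := by
      intro A hA
      obtain ⟨u, huT, hu⟩ := not_disjoint_iff.1 (hTA A hA)
      exact mem_biUnion.2 ⟨u, huT, mem_filter.2 ⟨hA, hu⟩⟩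
    have h1 := (card_le_card hsub).trans card_biUnion_le
    have h2 : ∑ v ∈ T, 4 * (k * {A ∈ F | v ∈ A}.card)
        ≤ T.card * (V.card - 1).choose (k - 1) := by
      rw [← smul_eq_mul (T.card)]
      exact sum_le_card_nsmul _ _ _ fun v _ =>
        card_filter_mem_avoiding_le hk hs hn hS hSc hB hmono hr hst v
    rw [← mul_sum, ← mul_sum] at h2
    have h3 := Nat.mul_le_mul_right ((V.card - 1).choose (k - 1)) hT
    have h4 := Nat.mul_le_mul_left (4 * k) h1
    refine Nat.le_of_mul_le_mul_left (c := k) ?_ (by omega)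
    linarith
  have := card_filter_add_card_filter_not (s := B 0) (fun A => Disjoint A S)
  omega

/-- The bound for nested overlapping families on an arbitrary finite ground set. -/
theorem overlapping_bound {k : ℕ} (hk : 1 ≤ k) (s : ℕ) (V : Finset α) (p : ℕ)
    (hn : 4 * k ^ 2 * s ≤ V.card) (B : ℕ → Finset (Finset α))
    (hB : ∀ i, B i ⊆ powersetCard k V) (hmono : Monotone B) (hr : ¬ HasRainbow B s) :
    p * (B 0).card + ∑ i ∈ range s, (B (i + 1)).card ≤
      max (s * V.card.choose k) ((p + s) * (V.card.choose k - (V.card - s).choose k)) := by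
  induction s generalizing V p B with
  | zero => simp [eq_empty_of_not_hasRainbow_zero hr]
  | succ t ih =>
  have hkk : 1 ≤ k ^ 2 := Nat.one_le_pow _ _ hk
  have htn : t + 1 ≤ V.card := by nlinarith
  obtain ⟨S, hS, hSc⟩ := exists_subset_card_eq htn
  obtain ⟨B, hcard, hB, hmono, hr, hst⟩ := exists_shifted hS B hB hmono hr
  simp only [← hcard]
  have hcardN : ∀ i, (B i).card ≤ V.card.choose k := fun i => by
    simpa using card_le_card (hB i)
  have hmemB : ∀ i, ∀ A ∈ B i, A ⊆ V ∧ A.card = k := fun i A hA => mem_powersetCard.1 (hB i hA)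
  -- a large last family always extends a rainbow matching
  by_cases hlast : (t + 1) * k * (V.card - 1).choose (k - 1) < (B (t + 1)).card
  · have hrt : ¬ HasRainbow B t := by
      rintro ⟨f, hf, hd⟩
      have hTc := card_biUnion_range_le (fun i hi => (hmemB i _ (hf i hi)).2)
      obtain ⟨A, hA, hAT⟩ := exists_disjoint_of_lt_card (T := (range (t + 1)).biUnion f)
        (hB (t + 1))
        (biUnion_subset.2 fun i hi => (hmemB i _ (hf i (Nat.lt_succ_iff.1 (mem_range.1 hi)))).1)
        (lt_of_le_of_lt (Nat.mul_le_mul_right _ hTc) hlast)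
      rw [disjoint_biUnion_right] at hAT
      exact hr (HasRainbow.snoc hA hf hd fun i hi => hAT i (mem_range.2 (by omega)))
    have hIH := ih V p (le_trans (Nat.mul_le_mul_left _ (by omega)) hn) B hB hmono hrt
    rw [sum_range_succ, ← add_assoc]
    refine (add_le_add hIH (hcardN (t + 1))).trans ?_
    rw [← max_add_add_right]
    refine max_le (le_trans (le_of_eq (by ring)) (le_max_left _ _)) ?_
    have := add_mul_sub_choose_le_max (n := V.card) (k := k) (p := p) (Nat.le_succ t) htn
    simpa using this
  -- a vertex of large degree in the first family always extends a rainbow matching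
  by_cases hext : ∃ v ∈ V, ∀ T ⊆ V, v ∉ T → T.card ≤ (t + 1) * k →
      ∃ A ∈ B 0, v ∈ A ∧ Disjoint A T
  · obtain ⟨v, hv, hext⟩ := hext
    let C : ℕ → Finset (Finset α) := fun i => {A ∈ B (i + 1) | v ∉ A}
    have hVc : (V.erase v).card = V.card - 1 := card_erase_of_mem hv
    have hC : ∀ i, C i ⊆ powersetCard k (V.erase v) := fun i A hA => by
      obtain ⟨hA, hvA⟩ := mem_filter.1 hA
      exact mem_powersetCard.2 ⟨subset_erase.2 ⟨(hmemB _ A hA).1, hvA⟩, (hmemB _ A hA).2⟩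
    have hCr : ¬ HasRainbow C t := by
      rintro ⟨f, hf, hd⟩
      have hf' : ∀ i ≤ t, f i ∈ B (i + 1) ∧ v ∉ f i := fun i hi => mem_filter.1 (hf i hi)
      have hTc := card_biUnion_range_le (fun i hi => (hmemB _ _ (hf' i hi).1).2)
      obtain ⟨A, hA, -, hAT⟩ := hext ((range (t + 1)).biUnion f)
        (biUnion_subset.2 fun i hi =>
          (hmemB _ _ (hf' i (Nat.lt_succ_iff.1 (mem_range.1 hi))).1).1)
        (by
          simp only [mem_biUnion, mem_range, not_exists, not_and]
          exact fun i hi => (hf' i (by omega)).2) hTc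
      rw [disjoint_biUnion_right] at hAT
      exact hr (HasRainbow.cons hA (fun i hi => (hf' i hi).1) hd
        fun i hi => hAT i (mem_range.2 (by omega)))
    have hIH := ih (V.erase v) (p + 1) (by rw [hVc]; rw [mul_add, mul_one] at hn; omega) C hC
      (fun i j hij => filter_subset_filter _ (hmono (by omega))) hCr
    rw [hVc] at hIH
    have hBC : ∀ i, (B (i + 1)).card ≤ (C i).card + (V.card - 1).choose (k - 1) := by
      intro i
      have h1 := card_filter_add_card_filter_not (s := B (i + 1)) (fun A => v ∈ A)
      have h2 := (card_le_card (filter_subset_filter (fun A => v ∈ A) (hB (i + 1)))).trans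
        (card_filter_mem_powersetCard_le hv k)
      simp only [C]
      omega
    have h0 : p * (B 0).card ≤ p * (C 0).card + p * (V.card - 1).choose (k - 1) := by
      rw [← mul_add]
      exact Nat.mul_le_mul_left p ((card_le_card (hmono (Nat.zero_le 1))).trans (hBC 0))
    have hsum : ∑ i ∈ range (t + 1), (B (i + 1)).card ≤
        ∑ i ∈ range (t + 1), (C i).card + (t + 1) * (V.card - 1).choose (k - 1) := by
      refine (sum_le_sum fun i _ => hBC i).trans (le_of_eq ?_)
      rw [sum_add_distrib, sum_const, card_range, smul_eq_mul]
    rw [sum_range_succ' fun i => (C i).card] at hsum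
    have hpascal : V.card.choose k = (V.card - 1).choose (k - 1) + (V.card - 1).choose k := by
      obtain ⟨k, rfl⟩ := Nat.exists_eq_add_of_le' hk
      obtain ⟨m, hm⟩ : ∃ m, V.card = m + 1 := ⟨V.card - 1, by omega⟩
      rw [hm]
      simp [Nat.choose_succ_succ]
    have htotal : p * (B 0).card + ∑ i ∈ range (t + 1), (B (i + 1)).card ≤
        (p + (t + 1)) * (V.card - 1).choose (k - 1) +
          ((p + 1) * (C 0).card + ∑ i ∈ range t, (C (i + 1)).card) := by
      linarith
    refine htotal.trans ((Nat.add_le_add_left hIH _).trans ?_)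
    rw [← max_add_add_left]
    refine max_le ?_ ?_
    · have := add_mul_sub_choose_le_max (n := V.card) (k := k) (p := p) (s := t + 1) (i := 1)
        (by omega) htn
      refine le_trans (le_of_eq ?_) this
      rw [show V.card.choose k - (V.card - 1).choose k = (V.card - 1).choose (k - 1) by omega,
        hpascal, Nat.add_sub_cancel]
      ring
    · refine le_trans (le_of_eq ?_) (le_max_right _ _)
      have hle : (V.card - (t + 1)).choose k ≤ (V.card - 1).choose k :=
        Nat.choose_le_choose _ (by omega)
      rw [show V.card - 1 - t = V.card - (t + 1) by omega, show p + 1 + t = p + (t + 1) by ring,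
        ← mul_add, hpascal, Nat.add_sub_assoc hle]
  have hB0 : 2 * (B 0).card ≤ (t + 1) * (V.card - 1).choose (k - 1) ∧ (k = 1 → B 0 = ∅) := by
    have hk1 : k = 1 → B 0 = ∅ := by
      rintro rfl
      by_contra hne
      obtain ⟨A, hA⟩ := nonempty_iff_ne_empty.2 hne
      obtain ⟨v, rfl⟩ := card_eq_one.1 (hmemB 0 A hA).2
      exact hext ⟨v, (hmemB 0 _ hA).1 (mem_singleton_self v), fun T _ hvT _ =>
        ⟨_, hA, mem_singleton_self v, disjoint_singleton_left.2 hvT⟩⟩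
    refine ⟨?_, hk1⟩
    rcases hk.eq_or_lt with rfl | hk2
    · simp [hk1 rfl]
    refine two_mul_card_le hk2 (by omega) hn hS hSc (hB 0) hmono hr hst fun v hv => ?_
    by_contra! hcon
    exact hext ⟨v, hS hv, fun T hT hvT hTc => exists_mem_disjoint_of_lt_card (hS hv) hvT (hB 0) hT
      (lt_of_le_of_lt (Nat.mul_le_mul_right _ hTc) hcon)⟩
  obtain ⟨hB0, hk1⟩ := hB0
  have hsumle : ∑ i ∈ range (t + 1), (B (i + 1)).card ≤
      (t + 1) * ((t + 1) * k * (V.card - 1).choose (k - 1)) := by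
    have := sum_le_card_nsmul (range (t + 1)) (fun i => (B (i + 1)).card) _ fun i hi =>
      (card_le_card (hmono (Nat.succ_le_of_lt (mem_range.1 hi)))).trans (not_lt.1 hlast)
    rwa [card_range, smul_eq_mul] at this
  have hN := four_mul_choose_pred_le hk hn
  have hN' := Nat.mul_le_mul_left (t + 1) hN
  rw [le_max_iff]
  by_cases hpb : 4 * (p * (B 0).card) ≤ 3 * ((t + 1) * V.card.choose k)
  · left
    linarith
  · right
    have hk2 : 2 ≤ k := by
      by_contra hk2
      exact hpb (by simp [hk1 (by omega)])
    have hH := three_mul_choose_pred_le hk2 (by omega) hn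
    have h1 : 3 * (B 0).card ≤ 2 * (V.card.choose k - (V.card - (t + 1)).choose k) := by omega
    have h2 := Nat.mul_le_mul_left p h1
    rw [add_mul]
    generalize V.card.choose k - (V.card - (t + 1)).choose k = H at *
    nlinarith

end Main

section Extremal

variable {α : Type*} [DecidableEq α]

lemma hasRainbowMatching_of_hasRainbow {s : ℕ} {B : Fin (s + 1) → Finset (Finset α)}
    {C : ℕ → Finset (Finset α)} (hC : ∀ i : Fin (s + 1), C i = B i) (h : HasRainbow C s) :
    HasRainbowMatching B (s + 1) := by
  obtain ⟨f, hf, hd⟩ := h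
  refine ⟨id, fun i => f i, strictMono_id, fun i => ?_, fun i j hij => ?_⟩
  · rw [id, ← hC i]
    exact hf i (Nat.lt_succ_iff.1 i.2)
  · exact hd i (Nat.lt_succ_iff.1 i.2) j (Nat.lt_succ_iff.1 j.2) fun h => hij (Fin.ext h)

lemma card_filter_not_disjoint_powersetCard (V S : Finset α) (hS : S ⊆ V) (k : ℕ) :
    {A ∈ powersetCard k V | ¬ Disjoint A S}.card
      = V.card.choose k - (V.card - S.card).choose k := by
  have h := card_filter_add_card_filter_not (s := powersetCard k V) (fun A => Disjoint A S)
  have hd : {A ∈ powersetCard k V | Disjoint A S} = powersetCard k (V \ S) := by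
    ext A
    simp only [mem_filter, mem_powersetCard, subset_sdiff]
    tauto
  rw [hd, card_powersetCard, card_powersetCard, card_sdiff_of_subset hS] at h
  omega

/-- More than `S.card` pairwise disjoint sets cannot all meet `S`. -/
lemma not_hasRainbowMatching_of_not_disjoint {m : ℕ} {B : Fin m → Finset (Finset α)}
    {S : Finset α} (hB : ∀ i, ∀ A ∈ B i, ¬ Disjoint A S) {t : ℕ} (ht : S.card < t) :
    ¬ HasRainbowMatching B t := by
  rintro ⟨idx, f, -, hf, hd⟩
  choose x hx hxS using fun a => not_disjoint_iff.1 (hB _ _ (hf a))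
  have hinj : Function.Injective x := fun a b hab => by
    by_contra hne
    exact disjoint_left.1 (hd a b hne) (hx a) (hab ▸ hx b)
  have := card_le_card_of_injOn (s := univ) (t := S) x (fun a _ => hxS a) hinj.injOn
  rw [card_univ, Fintype.card_fin] at this
  omega

end Extremal

/-- Theorem 1.2: for `n ≥ 4k²s`, the maximum of `p|ℬ₀| + |ℬ₁| + … + |ℬ_s|`
over nested overlapping families of `k`-subsets of `[n]` equals
`max { s·C(n,k), (p+s)·(C(n,k) − C(n−s,k)) }`. -/
theorem stmt1 (k s p n : ℕ) (hk : 0 < k) (hs : 0 < s) (hp : 0 < p)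
    (hn : 4 * k ^ 2 * s ≤ n) :
    IsGreatest {x : ℕ | ∃ B : Fin (s + 1) → Finset (Finset (Fin n)),
        (∀ i, ∀ A ∈ B i, A.card = k) ∧
        (∀ i j : Fin (s + 1), i ≤ j → B i ⊆ B j) ∧
        ¬ HasRainbowMatching B (s + 1) ∧
        x = p * (B 0).card + ∑ i : Fin s, (B i.succ).card}
      (max (s * n.choose k) ((p + s) * (n.choose k - (n - s).choose k))) := by
  constructor
  · rcases le_total (s * n.choose k) ((p + s) * (n.choose k - (n - s).choose k)) with h | h
    · rw [max_eq_right h]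
      have hsn : s ≤ (univ : Finset (Fin n)).card := by
        rw [card_univ, Fintype.card_fin]
        exact (Nat.le_mul_of_pos_left s (by positivity)).trans hn
      obtain ⟨S, -, hS⟩ := exists_subset_card_eq hsn
      refine ⟨fun _ => {A ∈ powersetCard k univ | ¬ Disjoint A S}, ?_, fun _ _ _ => le_rfl,
        not_hasRainbowMatching_of_not_disjoint (S := S) ?_ (hS ▸ Nat.lt_succ_self s), ?_⟩
      · exact fun _ A hA => (mem_powersetCard.1 (mem_filter.1 hA).1).2
      · exact fun _ A hA => (mem_filter.1 hA).2
      · rw [sum_const, card_filter_not_disjoint_powersetCard _ _ (subset_univ S), hS, card_univ,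
          card_univ, Fintype.card_fin, Fintype.card_fin, smul_eq_mul, add_mul]
    · rw [max_eq_left h]
      refine ⟨fun i => if i = 0 then ∅ else powersetCard k univ, ?_, ?_, ?_, ?_⟩
      · intro i A hA
        dsimp only at hA
        split_ifs at hA
        · simp at hA
        · exact (mem_powersetCard.1 hA).2
      · intro i j hij
        dsimp only
        split_ifs with hi hj hj
        · exact le_rfl
        · exact empty_subset _
        · exact absurd (Fin.le_zero_iff.1 (hj ▸ hij)) hi
        · exact le_rfl
      · rintro ⟨idx, f, hidx, hf, -⟩
        have h0 : idx 0 = 0 := by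
          obtain ⟨a, ha⟩ := (Finite.injective_iff_surjective.1 hidx.injective) 0
          exact Fin.le_zero_iff.1 ((hidx.monotone (Fin.zero_le a)).trans ha.le)
        simpa [h0] using hf 0
      · simp [Fin.succ_ne_zero]
  · rintro x ⟨B, hk', hmono, hr, rfl⟩
    let C : ℕ → Finset (Finset (Fin n)) := fun i => B ⟨min i s, by omega⟩
    have hC : ∀ i : Fin (s + 1), C i = B i := fun i =>
      congrArg B (Fin.ext (min_eq_left (Nat.lt_succ_iff.1 i.2)))
    have hb := overlapping_bound (V := (univ : Finset (Fin n))) hk s p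
      (by rwa [card_univ, Fintype.card_fin]) C
      (fun i A hA => mem_powersetCard.2 ⟨subset_univ _, hk' _ A hA⟩)
      (fun i j hij => hmono _ _ (Fin.mk_le_mk.2 (min_le_min_right s hij)))
      (fun h => hr (hasRainbowMatching_of_hasRainbow hC h))
    rw [card_univ, Fintype.card_fin, ← Fin.sum_univ_eq_sum_range fun i => (C (i + 1)).card] at hb
    have h0 : C 0 = B 0 := hC 0
    have hsucc : ∀ i : Fin s, C (i + 1) = B i.succ := fun i => hC i.succ
    simpa only [h0, hsucc] using hb
end

section
/- Let k, s be positive integers, let n = (s+1)k, and let p₀ ≥ p₁ ≥ … ≥ p_s > 0 be real numbers. Then the maximum of Σ_{i=0}^{s} p_i·|ℬ_i| over all nested overlapping sequences ℬ₀ ⊆ ℬ₁ ⊆ … ⊆ ℬ_s of families of k-element subsets of [n] = {1,…,n} equals (p₀ + p₁ + … + p_s)·C((s+1)k − 1, k), where C(a,b) denotes the binomial coefficient. -/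
open Finset in
/-- The number of permutations mapping `Q` onto `A` is the same for all `A` with `#A = #Q`. -/
theorem card_perm_map_eq_const {α : Type*} [DecidableEq α] [Fintype α] (Q A : Finset α)
    (h : A.card = Q.card) :
    (univ.filter fun σ : Equiv.Perm α => Q.map σ.toEmbedding = A).card =
      (univ.filter fun σ : Equiv.Perm α => Q.map σ.toEmbedding = Q).card := by
  let τ : Equiv.Perm α := (Finset.equivOfCardEq h.symm).extendSubtype
  have hτ : Q.map τ.toEmbedding = A := by
    apply eq_of_subset_of_card_le
    · intro x hx
      obtain ⟨y, hy, rfl⟩ := mem_map.1 hx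
      exact (Finset.equivOfCardEq h.symm).extendSubtype_mem y hy
    · rw [card_map, h]
  symm
  refine card_bij (fun σ _ => σ.trans τ) ?_ ?_ ?_
  · intro σ hσ
    simp only [mem_filter, mem_univ, true_and] at hσ ⊢
    change Q.map (σ.toEmbedding.trans τ.toEmbedding) = A
    rw [← map_map, hσ, hτ]
  · intro σ _ σ' _ he
    ext x
    simpa using congrArg (fun f => f x) he
  · intro σ hσ
    simp only [mem_filter, mem_univ, true_and] at hσ
    refine ⟨σ.trans τ.symm, ?_, by ext; simp⟩
    simp only [mem_filter, mem_univ, true_and]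
    apply map_injective τ.toEmbedding
    rw [hτ, map_map, ← hσ]
    congr 1
    ext; simp

open Finset in
/-- Double counting pairs of a permutation and the member of `B` onto which it maps `Q`. -/
theorem card_perm_map_mem {α : Type*} [DecidableEq α] [Fintype α] (Q : Finset α)
    (B : Finset (Finset α)) (hB : ∀ A ∈ B, A.card = Q.card) :
    (univ.filter fun σ : Equiv.Perm α => Q.map σ.toEmbedding ∈ B).card *
      (Fintype.card α).choose Q.card = (Fintype.card α).factorial * B.card := by
  have key : ∀ C : Finset (Finset α), (∀ A ∈ C, A.card = Q.card) →
      (univ.filter fun σ : Equiv.Perm α => Q.map σ.toEmbedding ∈ C).card =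
        C.card * (univ.filter fun σ : Equiv.Perm α => Q.map σ.toEmbedding = Q).card := by
    intro C hC
    rw [card_eq_sum_card_fiberwise (f := fun σ : Equiv.Perm α => Q.map σ.toEmbedding) (t := C)
      (by intro σ hσ; simpa using hσ)]
    rw [← smul_eq_mul, ← sum_const]
    refine sum_congr rfl fun A hA => ?_
    rw [← card_perm_map_eq_const Q A (hC A hA), filter_filter]
    congr 1
    ext σ
    simp only [mem_filter, mem_univ, true_and]
    exact ⟨fun h => h.2, fun h => ⟨h ▸ hA, h⟩⟩
  have hall := key (powersetCard Q.card univ) (fun A hA => (mem_powersetCard.1 hA).2)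
  rw [card_powersetCard, card_univ, filter_true_of_mem
    (by intro σ _; simp [mem_powersetCard]), card_univ, Fintype.card_perm] at hall
  rw [key B hB, hall]
  ring

/-- If the `i`-th family contains at least `i + 1` of the pairwise disjoint sets `P j`, then
there is a full rainbow matching. -/
theorem hasRainbowMatching_of_lt_card {α : Type*} [DecidableEq α] {m : ℕ}
    (B : Fin m → Finset (Finset α)) (P : Fin m → Finset α)
    (hP : ∀ a b, a ≠ b → Disjoint (P a) (P b))
    (h : ∀ i : Fin m, (i : ℕ) < (Finset.univ.filter fun j => P j ∈ B i).card) :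
    HasRainbowMatching B m := by
  obtain ⟨f, hf, hfm⟩ := (Finset.all_card_le_biUnion_card_iff_exists_injective
    (fun i : Fin m => Finset.univ.filter fun j => P j ∈ B i)).1 (by
      intro S
      rcases S.eq_empty_or_nonempty with rfl | hS
      · simp
      have h1 : S.card ≤ (S.max' hS : ℕ) + 1 := by
        rw [← Fin.card_Iic]
        exact Finset.card_le_card fun x hx => Finset.mem_Iic.2 (S.le_max' x hx)
      exact (h1.trans (h _)).trans
        (Finset.card_le_card (Finset.subset_biUnion_of_mem
          (fun i : Fin m => Finset.univ.filter fun j => P j ∈ B i) (S.max'_mem hS))))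
  exact ⟨id, fun i => P (f i), strictMono_id, fun i => by simpa using hfm i,
    fun a b hab => hP _ _ (hf.ne hab)⟩

/-- A weighted sum with non-increasing weights in which the first `i₀ + 1` coefficients are at
most `i₀` and all coefficients are at most `s + 1`. -/
theorem sum_mul_le_of_le {s : ℕ} (p : ℕ → ℝ) (hpos : ∀ i ≤ s, 0 < p i)
    (hmono : ∀ i j : ℕ, i ≤ j → j ≤ s → p j ≤ p i) (x : Fin (s + 1) → ℕ) (i₀ : Fin (s + 1))
    (hx : ∀ i, x i ≤ s + 1) (hx₀ : ∀ i ≤ i₀, x i ≤ i₀) :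
    ∑ i : Fin (s + 1), p i * (x i : ℝ) ≤ s * ∑ i : Fin (s + 1), p i := by
  have hi₀ : (i₀ : ℕ) ≤ s := Nat.lt_succ_iff.1 i₀.2
  have hi₀' : (i₀ : ℝ) ≤ s := by exact_mod_cast hi₀
  have hp₀ := hpos i₀ hi₀
  -- termwise bound, with the loss `s - i₀` collected at the index `i₀`
  have hterm : ∀ i : Fin (s + 1), p i * (x i : ℝ) - s * p i ≤
      (if i = i₀ then -((s - i₀ : ℝ) * p i₀) else 0) + (if i₀ < i then p i₀ else 0) := by
    intro i
    have hpi := hpos i (Nat.lt_succ_iff.1 i.2)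
    rcases lt_trichotomy i i₀ with h | h | h
    · have : (x i : ℝ) ≤ i₀ := by exact_mod_cast hx₀ i h.le
      simp only [h.ne, h.not_gt, if_false]
      nlinarith
    · subst h
      have : (x i : ℝ) ≤ i := by exact_mod_cast hx₀ i le_rfl
      simp only [lt_irrefl, if_true, if_false]
      nlinarith
    · have h1 : (x i : ℝ) ≤ s + 1 := by exact_mod_cast hx i
      have h2 := hmono i₀ i (by exact_mod_cast h.le) (Nat.lt_succ_iff.1 i.2)
      simp only [h.ne', h, if_true, if_false]
      nlinarith
  have hsum := Finset.sum_le_sum fun i (_ : i ∈ Finset.univ) => hterm i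
  rw [Finset.sum_sub_distrib, Finset.sum_add_distrib, ← Finset.mul_sum,
    Finset.sum_ite_eq' Finset.univ i₀, ← Finset.sum_filter, Finset.sum_const] at hsum
  have hc : (Finset.univ.filter fun i => i₀ < i).card = s - i₀ := by
    rw [Finset.filter_lt_eq_Ioi, Fin.card_Ioi]
    omega
  rw [hc, nsmul_eq_mul, Nat.cast_sub hi₀] at hsum
  simp only [Finset.mem_univ, if_true] at hsum
  linarith

open Finset in
/-- A full rainbow matching of `k`-sets covers all `(s + 1) * k` points, so the families of
`k`-sets avoiding a given point are overlapping. -/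
theorem not_hasRainbowMatching_powersetCard_erase {k s : ℕ} (a : Fin ((s + 1) * k)) :
    ¬ HasRainbowMatching (fun _ : Fin (s + 1) => powersetCard k (univ.erase a)) (s + 1) := by
  rintro ⟨idx, f, -, hf, hd⟩
  have hf' : ∀ i, f i ⊆ univ.erase a ∧ (f i).card = k := fun i => mem_powersetCard.1 (hf i)
  have h1 : (univ.biUnion f).card = (s + 1) * k := by
    rw [card_biUnion fun i _ j _ hij => hd i j hij, sum_congr rfl fun i _ => (hf' i).2]
    simp
  have h2 : (univ.biUnion f).card ≤ (univ.erase a).card :=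
    card_le_card (biUnion_subset.2 fun i _ => (hf' i).1)
  rw [h1, card_erase_of_mem (mem_univ a), card_univ, Fintype.card_fin] at h2
  have := a.pos
  omega

theorem succ_mul_choose_pred {k s : ℕ} (hk : 0 < k) :
    (s + 1) * ((s + 1) * k - 1).choose k = s * ((s + 1) * k).choose k := by
  have hn : (s + 1) * k - 1 + 1 = (s + 1) * k := Nat.sub_add_cancel (Nat.mul_pos s.succ_pos hk)
  have h := Nat.choose_mul_succ_eq ((s + 1) * k - 1) k
  rw [hn] at h
  have h' : (s + 1) * k - k = s * k := by rw [Nat.succ_mul]; omega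
  rw [h'] at h
  apply Nat.eq_of_mul_eq_mul_right hk
  linarith

open Finset in
/-- Averaging over all permutations of a fixed partition into `k`-sets. -/
theorem sum_weight_mul_card_le {k s : ℕ} (hk : 0 < k)
    (p : ℕ → ℝ) (hpos : ∀ i ≤ s, 0 < p i)
    (hmono : ∀ i j : ℕ, i ≤ j → j ≤ s → p j ≤ p i)
    (B : Fin (s + 1) → Finset (Finset (Fin ((s + 1) * k))))
    (hB : ∀ i, ∀ A ∈ B i, A.card = k) (hnest : ∀ i j : Fin (s + 1), i ≤ j → B i ⊆ B j)
    (hov : ¬ HasRainbowMatching B (s + 1)) :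
    ∑ i : Fin (s + 1), p i * ((B i).card : ℝ) ≤
      (∑ i : Fin (s + 1), p i) * (((s + 1) * k - 1).choose k : ℝ) := by
  let Q : Fin (s + 1) → Finset (Fin ((s + 1) * k)) := fun j =>
    univ.map ((Function.Embedding.sectR j (Fin k)).trans finProdFinEquiv.toEmbedding)
  have hQ : ∀ j, (Q j).card = k := fun j => by simp [Q]
  have hQd : ∀ a b, a ≠ b → Disjoint (Q a) (Q b) := by
    intro a b hab
    rw [disjoint_left]
    intro x hx hy
    obtain ⟨u, -, rfl⟩ := mem_map.1 hx
    obtain ⟨v, -, hv⟩ := mem_map.1 hy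
    have := finProdFinEquiv.injective hv
    exact hab (congrArg Prod.fst this).symm
  let P : Equiv.Perm (Fin ((s + 1) * k)) → Fin (s + 1) → Finset (Fin ((s + 1) * k)) :=
    fun σ j => (Q j).map σ.toEmbedding
  let x : Equiv.Perm (Fin ((s + 1) * k)) → Fin (s + 1) → ℕ :=
    fun σ i => (univ.filter fun j => P σ j ∈ B i).card
  have hσ : ∀ σ, ∑ i : Fin (s + 1), p i * (x σ i : ℝ) ≤ s * ∑ i : Fin (s + 1), p i := by
    intro σ
    obtain ⟨i₀, hi₀⟩ : ∃ i₀ : Fin (s + 1), x σ i₀ ≤ i₀ := by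
      by_contra! h
      exact hov (hasRainbowMatching_of_lt_card B (P σ)
        (fun a b hab => (disjoint_map _).2 (hQd a b hab)) h)
    refine sum_mul_le_of_le p hpos hmono (x σ) i₀ (fun i => ?_) (fun i hi => ?_)
    · simpa using card_le_univ (univ.filter fun j => P σ j ∈ B i)
    · refine le_trans (card_le_card ?_) hi₀
      exact monotone_filter_right _ fun j _ hj => hnest i i₀ hi hj
  have hx : ∀ i, ((∑ σ, x σ i : ℕ) : ℝ) * (((s + 1) * k).choose k : ℝ) =
      (((s + 1) * k).factorial : ℝ) * ((s + 1) * ((B i).card : ℝ)) := by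
    intro i
    have h1 : ∑ σ, x σ i = ∑ j : Fin (s + 1), (univ.filter fun σ => P σ j ∈ B i).card := by
      simp only [x, card_filter]
      exact sum_comm
    have h2 : ∀ j : Fin (s + 1), (univ.filter fun σ => P σ j ∈ B i).card *
        ((s + 1) * k).choose k = ((s + 1) * k).factorial * (B i).card := by
      intro j
      have := card_perm_map_mem (Q j) (B i) (fun A hA => (hB i A hA).trans (hQ j).symm)
      rwa [hQ j, Fintype.card_fin] at this
    have h3 : (∑ σ, x σ i) * ((s + 1) * k).choose k =
        ((s + 1) * k).factorial * ((s + 1) * (B i).card) := by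
      rw [h1, sum_mul, sum_congr rfl fun j _ => h2 j]
      simp
      ring
    exact_mod_cast h3
  have htot : ∑ i : Fin (s + 1), p i * ((∑ σ, x σ i : ℕ) : ℝ) ≤
      (((s + 1) * k).factorial : ℝ) * (s * ∑ i : Fin (s + 1), p i) := by
    have h := sum_le_sum fun σ (_ : σ ∈ univ) => hσ σ
    rw [sum_comm, sum_const, card_univ, Fintype.card_perm, Fintype.card_fin, nsmul_eq_mul] at h
    simpa only [Nat.cast_sum, mul_sum] using h
  have hfac : (0 : ℝ) < (((s + 1) * k).factorial : ℝ) := by positivity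
  have hs1 : (0 : ℝ) < (s : ℝ) + 1 := by positivity
  have hch : ((s : ℝ) + 1) * (((s + 1) * k - 1).choose k : ℝ) =
      s * (((s + 1) * k).choose k : ℝ) := by exact_mod_cast succ_mul_choose_pred hk
  have hmul := mul_le_mul_of_nonneg_right htot
    (Nat.cast_nonneg (α := ℝ) (((s + 1) * k).choose k))
  have hl : (∑ i : Fin (s + 1), p i * ((∑ σ, x σ i : ℕ) : ℝ)) * (((s + 1) * k).choose k : ℝ) =
      (((s + 1) * k).factorial : ℝ) * (s + 1) * ∑ i : Fin (s + 1), p i * ((B i).card : ℝ) := by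
    rw [sum_mul, mul_sum]
    refine sum_congr rfl fun i _ => ?_
    rw [mul_assoc, hx i]
    ring
  refine le_of_mul_le_mul_left ?_ (mul_pos hfac hs1)
  rw [← hl]
  refine hmul.trans (le_of_eq ?_)
  linear_combination (-(((s + 1) * k).factorial : ℝ) * ∑ i : Fin (s + 1), p i) * hch

/-- Theorem 1.3: for `n = (s+1)k` and weights `p₀ ≥ p₁ ≥ … ≥ p_s > 0`, the
maximum of `∑ pᵢ|ℬᵢ|` over nested overlapping families of `k`-subsets of `[n]`
equals `(p₀ + … + p_s)·C((s+1)k − 1, k)`. -/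
theorem stmt2 (k s : ℕ) (hk : 0 < k) (hs : 0 < s)
    (p : ℕ → ℝ) (hpos : ∀ i ≤ s, 0 < p i)
    (hmono : ∀ i j : ℕ, i ≤ j → j ≤ s → p j ≤ p i) :
    IsGreatest {x : ℝ | ∃ B : Fin (s + 1) → Finset (Finset (Fin ((s + 1) * k))),
        (∀ i, ∀ A ∈ B i, A.card = k) ∧
        (∀ i j : Fin (s + 1), i ≤ j → B i ⊆ B j) ∧
        ¬ HasRainbowMatching B (s + 1) ∧
        x = ∑ i : Fin (s + 1), p (i : ℕ) * ((B i).card : ℝ)}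
      ((∑ i ∈ Finset.range (s + 1), p i) * (((s + 1) * k - 1).choose k : ℝ)) := by
  rw [Finset.sum_range]
  constructor
  · let a : Fin ((s + 1) * k) := ⟨0, by positivity⟩
    refine ⟨fun _ => Finset.powersetCard k (Finset.univ.erase a),
      fun i A hA => (Finset.mem_powersetCard.1 hA).2, fun i j _ => subset_rfl,
      not_hasRainbowMatching_powersetCard_erase a, ?_⟩
    simp only [Finset.card_powersetCard]
    rw [Finset.card_erase_of_mem (Finset.mem_univ a),
      Finset.card_univ, Fintype.card_fin, Finset.sum_mul]
  · rintro x ⟨B, hB, hnest, hov, rfl⟩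
    exact sum_weight_mul_card_le hk p hpos hmono B hB hnest hov
end

section
/- Let k, s be positive integers and let p₀ ≥ p₁ ≥ … ≥ p_s > 0 be real numbers. Set d = max over 1 ≤ i ≤ s of i·(p₀ + … + p_s)/(p₁ + … + p_i). If n ≥ max{ (s+1)k, ⌈d⌉·k }, then the maximum of Σ_{i=0}^{s} p_i·|ℬ_i| over all nested overlapping sequences ℬ₀ ⊆ ℬ₁ ⊆ … ⊆ ℬ_s of families of k-element subsets of [n] = {1,…,n} equals (p₁ + … + p_s)·C(n,k), where C(a,b) denotes the binomial coefficient. -/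
open Finset in
/-- All fibres of `σ ↦ σ(K)` over sets of the size of `K` have the same size. -/
lemma card_perm_map_eq_mul_choose_s3 {n k : ℕ} (K A : Finset (Fin n)) (hK : #K = k) (hA : #A = k) :
    #{σ : Equiv.Perm (Fin n) | K.map σ.toEmbedding = A} * n.choose k = n.factorial := by
  have hconst : ∀ A' ∈ powersetCard k (univ : Finset (Fin n)),
      #{σ : Equiv.Perm (Fin n) | K.map σ.toEmbedding = A'} =
        #{σ : Equiv.Perm (Fin n) | K.map σ.toEmbedding = A} := by
    intro A' hA'
    have hA'k := (mem_powersetCard.1 hA').2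
    have e : {x // x ∈ A'} ≃ {x // x ∈ A} := Finset.equivOfCardEq (hA'k.trans hA.symm)
    obtain ⟨τ, hτ⟩ : ∃ τ : Equiv.Perm (Fin n), A'.map τ.toEmbedding = A := by
      refine ⟨e.extendSubtype, ?_⟩
      apply Finset.eq_of_subset_of_card_le
      · intro y hy
        obtain ⟨x, hx, rfl⟩ := Finset.mem_map.1 hy
        exact e.extendSubtype_mem x hx
      · rw [card_map, hA, hA'k]
    refine Finset.card_equiv (Equiv.mulLeft τ) fun σ => ?_
    simp only [mem_filter, mem_univ, true_and, Equiv.coe_mulLeft]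
    have : K.map (τ * σ).toEmbedding =
        (K.map σ.toEmbedding).map τ.toEmbedding := by
      rw [Finset.map_map]; rfl
    rw [this, ← hτ, Finset.map_inj]
  have h := card_eq_sum_card_fiberwise (s := (univ : Finset (Equiv.Perm (Fin n))))
    (t := powersetCard k (univ : Finset (Fin n))) (f := fun σ => K.map σ.toEmbedding)
    (fun σ _ => by simp [hK])
  rw [sum_congr rfl hconst, sum_const, card_powersetCard, card_univ, card_univ,
    Fintype.card_perm, Fintype.card_fin, smul_eq_mul] at h
  rw [h, mul_comm]

open Finset in
/-- The number of permutations sending `K` into a uniform family is proportional to the size of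
the family. -/
lemma card_perm_map_mem_mul_choose {n k : ℕ} (K : Finset (Fin n)) (hK : #K = k)
    (B : Finset (Finset (Fin n))) (hB : ∀ A ∈ B, #A = k) :
    #{σ : Equiv.Perm (Fin n) | K.map σ.toEmbedding ∈ B} * n.choose k = #B * n.factorial := by
  have h := card_eq_sum_card_fiberwise
    (s := ({σ : Equiv.Perm (Fin n) | K.map σ.toEmbedding ∈ B} : Finset _))
    (t := B) (f := fun σ => K.map σ.toEmbedding) (fun σ hσ => by simpa using hσ)
  rw [h, sum_mul, ← smul_eq_mul, ← sum_const]
  refine sum_congr rfl fun A hA => ?_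
  rw [← card_perm_map_eq_mul_choose_s3 K A hK (hB A hA)]
  congr 2
  ext σ
  simp only [mem_filter, mem_univ, true_and, and_iff_right_iff_imp]
  rintro rfl
  exact hA

open Finset in
/-- A sequence of families without a full rainbow matching has, for any pairwise disjoint sets `K j`,
an index `i` such that at most `i` of the `K j` belong to the `i`-th family. -/
lemma exists_card_le_of_not_hasRainbowMatching {α : Type*} [DecidableEq α] {s m : ℕ}
    (B : Fin (s + 1) → Finset (Finset α))
    (hrain : ¬ HasRainbowMatching B (s + 1)) (K : Fin m → Finset α)
    (hK : ∀ a b, a ≠ b → Disjoint (K a) (K b)) :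
    ∃ i : Fin (s + 1), #{j | K j ∈ B i} ≤ (i : ℕ) := by
  by_contra! hlt
  refine hrain ?_
  obtain ⟨g, hg, hgB⟩ := (Finset.all_card_le_biUnion_card_iff_exists_injective
    (fun i : Fin (s + 1) => ({j | K j ∈ B i} : Finset (Fin m)))).1 fun S => by
      rcases S.eq_empty_or_nonempty with rfl | hS
      · simp
      · have h1 : #S ≤ (S.max' hS : ℕ) + 1 := by
          have : S ⊆ Finset.Iic (S.max' hS) := fun x hx => mem_Iic.2 (S.le_max' x hx)
          simpa using card_le_card this
        exact (h1.trans (hlt (S.max' hS))).trans (card_le_card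
          (subset_biUnion_of_mem (fun i : Fin (s + 1) => ({j | K j ∈ B i} : Finset (Fin m)))
            (S.max'_mem hS)))
  exact ⟨id, fun i => K (g i), strictMono_id, fun i => by simpa using hgB i,
    fun a b hab => hK _ _ (hg.ne hab)⟩

open Finset in
/-- Bound for a weighted sum of a monotone sequence `x` with values at most `m` and `x i ≤ i`
for some `i`. -/
lemma sum_mul_le_of_apply_le {s m : ℕ} (p : ℕ → ℝ) (hp : ∀ i ≤ s, 0 ≤ p i)
    (hm : ∀ i ∈ Icc 1 s, i * ∑ j ∈ range (s + 1), p j ≤ m * ∑ j ∈ Icc 1 i, p j)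
    (x : Fin (s + 1) → ℕ) (hx : Monotone x) (hxm : ∀ i, x i ≤ m)
    (i : Fin (s + 1)) (hi : x i ≤ i) :
    ∑ j : Fin (s + 1), p j * x j ≤ m * ∑ j ∈ Icc 1 s, p j := by
  have his : (i : ℕ) ≤ s := Nat.lt_succ_iff.1 i.2
  have hle : ∑ j : Fin (s + 1), p j * x j ≤
      ∑ j ∈ range (s + 1), p j * (if j ≤ (i : ℕ) then (i : ℝ) else m) := by
    rw [← Fin.sum_univ_eq_sum_range (fun j => p j * (if j ≤ (i : ℕ) then (i : ℝ) else m))]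
    refine sum_le_sum fun j _ => mul_le_mul_of_nonneg_left ?_ (hp j (Nat.lt_succ_iff.1 j.2))
    split_ifs with h
    · exact_mod_cast (hx (show j ≤ i from h)).trans hi
    · exact_mod_cast hxm j
  refine hle.trans ?_
  rw [← sum_range_add_sum_Ico _ (show (i : ℕ) + 1 ≤ s + 1 by omega)]
  have h1 : ∑ j ∈ range ((i : ℕ) + 1), p j * (if j ≤ (i : ℕ) then (i : ℝ) else m) =
      i * ∑ j ∈ range ((i : ℕ) + 1), p j := by
    rw [mul_sum]
    refine sum_congr rfl fun j hj => ?_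
    rw [if_pos (by have := mem_range.1 hj; omega), mul_comm]
  have h2 : ∑ j ∈ Ico ((i : ℕ) + 1) (s + 1), p j * (if j ≤ (i : ℕ) then (i : ℝ) else m) =
      m * ∑ j ∈ Ico ((i : ℕ) + 1) (s + 1), p j := by
    rw [mul_sum]
    refine sum_congr rfl fun j hj => ?_
    rw [if_neg (by have := mem_Ico.1 hj; omega), mul_comm]
  have h3 : ∑ j ∈ Icc 1 s, p j =
      ∑ j ∈ Icc 1 (i : ℕ), p j + ∑ j ∈ Ico ((i : ℕ) + 1) (s + 1), p j :=
    (sum_Ico_consecutive p (show 1 ≤ (i : ℕ) + 1 by omega)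
      (show (i : ℕ) + 1 ≤ s + 1 by omega)).symm
  have h4 : ∑ j ∈ range ((i : ℕ) + 1), p j ≤ ∑ j ∈ range (s + 1), p j :=
    sum_le_sum_of_subset_of_nonneg (range_mono (by omega))
      fun j hj _ => hp j (Nat.lt_succ_iff.1 (mem_range.1 hj))
  have h5 : (i : ℝ) * ∑ j ∈ range ((i : ℕ) + 1), p j ≤ m * ∑ j ∈ Icc 1 (i : ℕ), p j := by
    rcases Nat.eq_zero_or_pos (i : ℕ) with h0 | h0
    · simp [h0]
    · exact (mul_le_mul_of_nonneg_left h4 (Nat.cast_nonneg _)).trans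
        (hm i (mem_Icc.2 ⟨h0, his⟩))
  rw [h1, h2, h3, mul_add]
  linarith

open Finset in
/-- Averaging over all images of `m` disjoint `k`-sets under permutations of the ground set. -/
lemma sum_mul_card_le_of_not_hasRainbowMatching {k s n m : ℕ} (hm0 : 0 < m) (hmk : m * k ≤ n)
    (p : ℕ → ℝ) (hp : ∀ i ≤ s, 0 ≤ p i)
    (hm : ∀ i ∈ Icc 1 s, i * ∑ j ∈ range (s + 1), p j ≤ m * ∑ j ∈ Icc 1 i, p j)
    (B : Fin (s + 1) → Finset (Finset (Fin n))) (hcard : ∀ i, ∀ A ∈ B i, #A = k)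
    (hB : ∀ i j, i ≤ j → B i ⊆ B j) (hrain : ¬ HasRainbowMatching B (s + 1)) :
    ∑ i : Fin (s + 1), p i * #(B i) ≤ (∑ j ∈ Icc 1 s, p j) * n.choose k := by
  obtain ⟨e⟩ : Nonempty (Fin m × Fin k ↪ Fin n) :=
    Function.Embedding.nonempty_of_card_le (by simpa using hmk)
  let K : Fin m → Finset (Fin n) := fun j =>
    univ.map ⟨fun a : Fin k => e (j, a), fun a b h => by simpa using h⟩
  have hKcard : ∀ j, #(K j) = k := fun j => by simp [K]
  have hKdisj : ∀ a b, a ≠ b → Disjoint (K a) (K b) := by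
    intro a b hab
    rw [Finset.disjoint_left]
    intro y hy hy'
    obtain ⟨u, -, rfl⟩ := Finset.mem_map.1 hy
    obtain ⟨v, -, hv⟩ := Finset.mem_map.1 hy'
    exact hab (Prod.ext_iff.1 (e.injective hv)).1.symm
  let x : Equiv.Perm (Fin n) → Fin (s + 1) → ℕ := fun σ i =>
    #{j | (K j).map σ.toEmbedding ∈ B i}
  have hσ : ∀ σ, ∑ i : Fin (s + 1), p i * x σ i ≤ m * ∑ j ∈ Icc 1 s, p j := by
    intro σ
    obtain ⟨i, hi⟩ := exists_card_le_of_not_hasRainbowMatching B hrain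
      (fun j => (K j).map σ.toEmbedding)
      fun a b hab => (Finset.disjoint_map _).2 (hKdisj a b hab)
    refine sum_mul_le_of_apply_le p hp hm (x σ) ?_ ?_ i hi
    · intro a b hab
      exact card_le_card (monotone_filter_right _ fun j _ hj => hB a b hab hj)
    · intro a
      simpa using card_filter_le (univ : Finset (Fin m)) fun j => (K j).map σ.toEmbedding ∈ B a
  have hx : ∀ i, (∑ σ, x σ i) * n.choose k = m * #(B i) * n.factorial := by
    intro i
    have hswap : ∑ σ, x σ i =
        ∑ j, #{σ : Equiv.Perm (Fin n) | (K j).map σ.toEmbedding ∈ B i} := by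
      simp only [x, card_filter]
      exact sum_comm
    rw [hswap, sum_mul, sum_congr rfl fun j _ =>
      card_perm_map_mem_mul_choose (K j) (hKcard j) (B i) (hcard i)]
    simp [mul_assoc]
  have htotal := sum_le_sum fun σ (_ : σ ∈ (univ : Finset (Equiv.Perm (Fin n)))) => hσ σ
  rw [sum_comm, sum_const, card_univ, Fintype.card_perm, Fintype.card_fin, nsmul_eq_mul] at htotal
  have hmul := mul_le_mul_of_nonneg_right htotal (Nat.cast_nonneg (α := ℝ) (n.choose k))
  have hleft : (∑ i : Fin (s + 1), ∑ σ, p i * (x σ i : ℝ)) * n.choose k =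
      (m * n.factorial) * ∑ i : Fin (s + 1), p i * #(B i) := by
    rw [sum_mul, mul_sum]
    refine sum_congr rfl fun i _ => ?_
    have h : (∑ σ, (x σ i : ℝ)) * n.choose k = m * #(B i) * n.factorial := by
      exact_mod_cast hx i
    rw [← mul_sum, mul_assoc, h]
    ring
  rw [hleft] at hmul
  have hpos : (0 : ℝ) < m * n.factorial := by positivity
  refine le_of_mul_le_mul_left (hmul.trans_eq ?_) hpos
  ring

/-- Theorem 1.4: with `d = max_{1 ≤ i ≤ s} i(p₀+…+p_s)/(p₁+…+p_i)` and
`n ≥ max {(s+1)k, ⌈d⌉k}`, the maximum of `∑ pᵢ|ℬᵢ|` over nested overlapping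
families of `k`-subsets of `[n]` equals `(p₁+…+p_s)·C(n,k)`. -/
theorem stmt3 (k s n : ℕ) (hk : 0 < k) (hs : 0 < s)
    (p : ℕ → ℝ) (hpos : ∀ i ≤ s, 0 < p i)
    (hmono : ∀ i j : ℕ, i ≤ j → j ≤ s → p j ≤ p i)
    (d : ℝ)
    (hd : d = (Finset.Icc 1 s).sup' (Finset.nonempty_Icc.2 hs) fun i =>
        (i : ℝ) * (∑ j ∈ Finset.range (s + 1), p j) / (∑ j ∈ Finset.Icc 1 i, p j))
    (hn1 : (s + 1) * k ≤ n) (hn2 : ⌈d⌉.toNat * k ≤ n) :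
    IsGreatest {x : ℝ | ∃ B : Fin (s + 1) → Finset (Finset (Fin n)),
        (∀ i, ∀ A ∈ B i, A.card = k) ∧
        (∀ i j : Fin (s + 1), i ≤ j → B i ⊆ B j) ∧
        ¬ HasRainbowMatching B (s + 1) ∧
        x = ∑ i : Fin (s + 1), p (i : ℕ) * ((B i).card : ℝ)}
      ((∑ j ∈ Finset.Icc 1 s, p j) * (n.choose k : ℝ)) := by
  have hden : ∀ i ∈ Finset.Icc 1 s, 0 < ∑ j ∈ Finset.Icc 1 i, p j := fun i hi => by
    obtain ⟨h1, h2⟩ := Finset.mem_Icc.1 hi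
    exact Finset.sum_pos (fun j hj => hpos j ((Finset.mem_Icc.1 hj).2.trans h2))
      (Finset.nonempty_Icc.2 h1)
  have hnum : 0 < ∑ j ∈ Finset.range (s + 1), p j :=
    Finset.sum_pos (fun j hj => hpos j (Nat.lt_succ_iff.1 (Finset.mem_range.1 hj))) (by simp)
  have hdm : d ≤ (⌈d⌉.toNat : ℝ) :=
    (Int.le_ceil d).trans (by exact_mod_cast Int.self_le_toNat ⌈d⌉)
  have hle : ∀ i ∈ Finset.Icc 1 s,
      (i : ℝ) * (∑ j ∈ Finset.range (s + 1), p j) / (∑ j ∈ Finset.Icc 1 i, p j) ≤ d := by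
    intro i hi
    rw [hd]
    exact Finset.le_sup' (fun i : ℕ => (i : ℝ) * (∑ j ∈ Finset.range (s + 1), p j) /
      (∑ j ∈ Finset.Icc 1 i, p j)) hi
  have hone : 1 ∈ Finset.Icc 1 s := Finset.mem_Icc.2 ⟨le_rfl, hs⟩
  have hdpos : 0 < d := by
    refine lt_of_lt_of_le ?_ (hle 1 hone)
    have := hden 1 hone
    positivity
  constructor
  · refine ⟨fun i => if i = 0 then ∅ else Finset.powersetCard k Finset.univ, ?_, ?_, ?_, ?_⟩
    · intro i A hA
      dsimp only at hA
      split_ifs at hA with h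
      · simp at hA
      · exact (Finset.mem_powersetCard.1 hA).2
    · intro i j hij
      rcases eq_or_ne i 0 with rfl | hi
      · simp
      · have hj : j ≠ 0 := fun h => hi (Fin.le_zero_iff.1 (h ▸ hij))
        simp [hi, hj]
    · rintro ⟨idx, f, hidx, hf, -⟩
      obtain ⟨a, ha⟩ := (Finite.injective_iff_surjective.1 hidx.injective) 0
      simpa [ha] using hf a
    · rw [Fin.sum_univ_succ, Finset.sum_mul, ← Finset.Ico_add_one_right_eq_Icc,
        Finset.sum_Ico_eq_sum_range, ← Fin.sum_univ_eq_sum_range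
          (fun j => p (1 + j) * (n.choose k : ℝ)) (s + 1 - 1)]
      simp [add_comm]
  · rintro _ ⟨B, hcard, hB, hrain, rfl⟩
    refine sum_mul_card_le_of_not_hasRainbowMatching (m := ⌈d⌉.toNat) ?_ hn2 p
      (fun i hi => (hpos i hi).le) (fun i hi => ?_) B hcard hB hrain
    · exact_mod_cast hdpos.trans_le hdm
    · exact (div_le_iff₀ (hden i hi)).1 ((hle i hi).trans hdm)
end

section
/- Let n, k, m, s be positive integers with n ≥ (k+1)s and m ≥ s+1. Then f(n,k,m,s) equals the maximum of (m−s)·|ℬ₀| + |ℬ₁| + … + |ℬ_s| over all nested overlapping sequences ℬ₀ ⊆ ℬ₁ ⊆ … ⊆ ℬ_s of families of k-element subsets of [n] = {1,…,n}. -/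
namespace HasRainbowMatching

variable {α : Type*} [DecidableEq α] {m t : ℕ}

/-- The order of the chosen indices is irrelevant: distinctness is enough. -/
theorem of_injective {𝒜 : Fin m → Finset (Finset α)} (idx : Fin t → Fin m)
    (f : Fin t → Finset α) (hidx : Function.Injective idx) (hf : ∀ a, f a ∈ 𝒜 (idx a))
    (hdisj : ∀ a b, a ≠ b → Disjoint (f a) (f b)) : HasRainbowMatching 𝒜 t :=
  ⟨idx ∘ Tuple.sort idx, f ∘ Tuple.sort idx,
    (Tuple.monotone_sort idx).strictMono_of_injective
      (hidx.comp (Tuple.sort idx).injective),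
    fun _ => hf _, fun _ _ hab => hdisj _ _ ((Tuple.sort idx).injective.ne hab)⟩

/-- Replacing two families by their intersection and their union creates no new rainbow
matching size. -/
theorem of_uncross {𝒜 ℬ : Fin m → Finset (Finset α)} {i j : Fin m}
    (hi : ℬ i = 𝒜 i ∩ 𝒜 j) (hj : ℬ j = 𝒜 i ∪ 𝒜 j)
    (hne : ∀ l, l ≠ i → l ≠ j → ℬ l = 𝒜 l) (h : HasRainbowMatching ℬ t) :
    HasRainbowMatching 𝒜 t := by
  obtain ⟨idx, f, hidx, hf, hdisj⟩ := h
  by_cases hb : ∃ b, idx b = j ∧ f b ∈ 𝒜 i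
  · obtain ⟨b, hbj, hbi⟩ := hb
    refine of_injective (Equiv.swap i j ∘ idx) f
      ((Equiv.swap i j).injective.comp hidx.injective) (fun a => ?_) hdisj
    have ha := hf a
    by_cases haj : idx a = j
    · obtain rfl : a = b := hidx.injective (haj.trans hbj.symm)
      simpa [haj] using hbi
    · by_cases hai : idx a = i
      · rw [hai, hi] at ha
        simpa [hai] using (Finset.mem_inter.1 ha).2
      · rw [hne _ hai haj] at ha
        simpa [Equiv.swap_apply_of_ne_of_ne hai haj] using ha
  · refine of_injective idx f hidx.injective (fun a => ?_) hdisj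
    have ha := hf a
    by_cases haj : idx a = j
    · rw [haj, hj] at ha
      rw [haj]
      exact (Finset.mem_union.1 ha).resolve_left fun h => hb ⟨a, haj, h⟩
    · by_cases hai : idx a = i
      · rw [hai, hi] at ha
        rw [hai]
        exact (Finset.mem_inter.1 ha).1
      · rwa [hne _ hai haj] at ha

end HasRainbowMatching

/-- Families without a rainbow matching of size `t` can be made nested while keeping the sum of
their sizes. -/
theorem exists_monotone_not_hasRainbowMatching {α : Type*} [DecidableEq α] [Fintype α]
    {m t k : ℕ} (𝒜 : Fin m → Finset (Finset α)) (hk : ∀ i, ∀ A ∈ 𝒜 i, A.card = k)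
    (h𝒜 : ¬ HasRainbowMatching 𝒜 t) :
    ∃ ℬ : Fin m → Finset (Finset α), (∀ i, ∀ A ∈ ℬ i, A.card = k) ∧
      ¬ HasRainbowMatching ℬ t ∧ ∑ i, (ℬ i).card = ∑ i, (𝒜 i).card ∧ Monotone ℬ := by
  classical
  obtain ⟨ℬ, hℬ, hmax⟩ := Finset.exists_max_image
    (Finset.univ.filter fun ℬ : Fin m → Finset (Finset α) =>
      (∀ i, ∀ A ∈ ℬ i, A.card = k) ∧ ¬ HasRainbowMatching ℬ t ∧
        ∑ i, (ℬ i).card = ∑ i, (𝒜 i).card)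
    (fun ℬ => ∑ i : Fin m, (i : ℕ) * (ℬ i).card) ⟨𝒜, by simpa using ⟨hk, h𝒜⟩⟩
  simp only [Finset.mem_filter, Finset.mem_univ, true_and] at hℬ hmax
  obtain ⟨hℬk, hℬt, hℬs⟩ := hℬ
  refine ⟨ℬ, hℬk, hℬt, hℬs, fun i j hij => ?_⟩
  by_contra hsub
  have hij' : i < j := hij.lt_of_ne fun h => hsub (h ▸ le_rfl)
  obtain ⟨𝒞, h𝒞⟩ : ∃ 𝒞, 𝒞 = Function.update (Function.update ℬ i (ℬ i ∩ ℬ j)) j (ℬ i ∪ ℬ j) :=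
    ⟨_, rfl⟩
  have hi : 𝒞 i = ℬ i ∩ ℬ j := by simp [h𝒞, hij'.ne]
  have hj : 𝒞 j = ℬ i ∪ ℬ j := by simp [h𝒞]
  have hne : ∀ l, l ≠ i → l ≠ j → 𝒞 l = ℬ l := fun l h1 h2 => by simp [h𝒞, h1, h2]
  have hsplit : ∀ g : Fin m → ℕ,
      ∑ l, g l = g i + (g j + ∑ l ∈ (Finset.univ.erase i).erase j, g l) := fun g => by
    rw [Finset.add_sum_erase _ _ (by simp [hij'.ne']), Finset.add_sum_erase _ _ (by simp)]
  have hrest : ∀ l ∈ (Finset.univ.erase i).erase j, 𝒞 l = ℬ l := fun l hl => by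
    simp only [Finset.mem_erase, Finset.mem_univ, and_true] at hl
    exact hne l hl.2 hl.1
  have hcard := Finset.card_inter_add_card_union (ℬ i) (ℬ j)
  have hlt : (ℬ i ∩ ℬ j).card < (ℬ i).card :=
    Finset.card_lt_card ⟨Finset.inter_subset_left, fun h =>
      hsub (h.trans Finset.inter_subset_right)⟩
  have h𝒞k : ∀ l, ∀ A ∈ 𝒞 l, A.card = k := by
    intro l A hA
    by_cases hli : l = i
    · rw [hli, hi] at hA
      exact hℬk i A (Finset.mem_inter.1 hA).1
    · by_cases hlj : l = j
      · rw [hlj, hj] at hA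
        exact (Finset.mem_union.1 hA).elim (hℬk i A) (hℬk j A)
      · exact hℬk l A (hne l hli hlj ▸ hA)
  have h𝒞s : ∑ l, (𝒞 l).card = ∑ l, (𝒜 l).card := by
    rw [← hℬs, hsplit, hsplit fun l => (ℬ l).card, hi, hj,
      Finset.sum_congr rfl fun l hl => congrArg Finset.card (hrest l hl)]
    omega
  have hle := hmax 𝒞 ⟨h𝒞k, fun h => hℬt (h.of_uncross hi hj hne), h𝒞s⟩
  have hrest' : ∑ l ∈ (Finset.univ.erase i).erase j, (l : ℕ) * (𝒞 l).card =
      ∑ l ∈ (Finset.univ.erase i).erase j, (l : ℕ) * (ℬ l).card :=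
    Finset.sum_congr rfl fun l hl => by rw [hrest l hl]
  rw [hsplit, hsplit fun l => (l : ℕ) * (ℬ l).card, hi, hj, hrest'] at hle
  have hij'' : (i : ℕ) < j := hij'
  nlinarith

/-- Splitting a sum over `Fin m` after the first `m - s` terms. -/
theorem sum_eq_sum_castLE_add_sum {m s : ℕ} (h : s ≤ m) (g : Fin m → ℕ) :
    ∑ i, g i = ∑ i : Fin (m - s), g (i.castLE (Nat.sub_le m s)) +
      ∑ i : Fin s, g ⟨m - s + i, by omega⟩ := by
  obtain ⟨d, rfl⟩ := Nat.exists_eq_add_of_le' h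
  have hd : d + s - s = d := by omega
  rw [Fin.sum_univ_add]
  congr 1
  · exact Fintype.sum_equiv (finCongr hd.symm) _ _ fun _ => rfl
  · refine Finset.sum_congr rfl fun i _ => congrArg g (Fin.ext ?_)
    simp

/-- Corollary 1: `f(n,k,m,s)`, the maximum of `|𝒜₁|+…+|𝒜_m|` over families of
`k`-subsets of `[n]` with rainbow matching number at most `s`, equals the
maximum of `(m−s)|ℬ₀| + |ℬ₁| + … + |ℬ_s|` over nested overlapping sequences
`ℬ₀ ⊆ ℬ₁ ⊆ … ⊆ ℬ_s` of families of `k`-subsets of `[n]`. -/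
theorem stmt4 (n k m s : ℕ) (hn : 0 < n) (hk : 0 < k) (hm : 0 < m) (hs : 0 < s)
    (h1 : (k + 1) * s ≤ n) (h2 : s + 1 ≤ m) :
    sSup {x : ℕ | ∃ 𝒜 : Fin m → Finset (Finset (Fin n)),
        (∀ i, ∀ A ∈ 𝒜 i, A.card = k) ∧
        ¬ HasRainbowMatching 𝒜 (s + 1) ∧
        x = ∑ i : Fin m, (𝒜 i).card} =
    sSup {x : ℕ | ∃ B : Fin (s + 1) → Finset (Finset (Fin n)),
        (∀ i, ∀ A ∈ B i, A.card = k) ∧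
        (∀ i j : Fin (s + 1), i ≤ j → B i ⊆ B j) ∧
        ¬ HasRainbowMatching B (s + 1) ∧
        x = (m - s) * (B 0).card + ∑ i : Fin s, (B i.succ).card} := by
  have hbdd : BddAbove {x : ℕ | ∃ 𝒜 : Fin m → Finset (Finset (Fin n)),
      (∀ i, ∀ A ∈ 𝒜 i, A.card = k) ∧ ¬ HasRainbowMatching 𝒜 (s + 1) ∧
      x = ∑ i : Fin m, (𝒜 i).card} := by
    refine ⟨∑ _i : Fin m, Fintype.card (Finset (Fin n)), ?_⟩
    rintro x ⟨𝒜, -, -, rfl⟩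
    exact Finset.sum_le_sum fun i _ => Finset.card_le_univ _
  have hsub : {x : ℕ | ∃ B : Fin (s + 1) → Finset (Finset (Fin n)),
        (∀ i, ∀ A ∈ B i, A.card = k) ∧
        (∀ i j : Fin (s + 1), i ≤ j → B i ⊆ B j) ∧
        ¬ HasRainbowMatching B (s + 1) ∧
        x = (m - s) * (B 0).card + ∑ i : Fin s, (B i.succ).card} ⊆
      {x : ℕ | ∃ 𝒜 : Fin m → Finset (Finset (Fin n)),
        (∀ i, ∀ A ∈ 𝒜 i, A.card = k) ∧ ¬ HasRainbowMatching 𝒜 (s + 1) ∧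
        x = ∑ i : Fin m, (𝒜 i).card} := by
    rintro x ⟨B, hB, hmono, hover, rfl⟩
    refine ⟨fun i => B ⟨i + 1 - (m - s), by omega⟩, fun i => hB _, ?_, ?_⟩
    · rintro ⟨idx, f, hidx, hf, hdisj⟩
      refine hover ⟨id, f, strictMono_id, fun a => hmono _ a ?_ (hf a), hdisj⟩
      have key : ∀ d : ℕ, ∀ a : Fin (s + 1), (a : ℕ) + d = s → (idx a : ℕ) + d < m := by
        intro d
        induction d with
        | zero => exact fun a _ => (idx a).isLt
        | succ d ih =>
          intro a ha
          have hlt : idx a < idx ⟨a + 1, by omega⟩ := hidx (Fin.lt_def.2 (Nat.lt_succ_self _))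
          have := ih ⟨a + 1, by omega⟩ (by simp only; omega)
          have hlt' := Fin.lt_def.1 hlt
          omega
      have := key (s - a) a (by omega)
      rw [Fin.le_def]
      simp only
      omega
    · rw [sum_eq_sum_castLE_add_sum (by omega : s ≤ m)]
      congr 1
      · rw [Finset.sum_congr rfl (g := fun _ => (B 0).card)]
        · simp
        · refine fun i _ => congrArg (fun j => (B j).card) (Fin.ext ?_)
          simp only [Fin.val_castLE, Fin.val_zero]
          omega
      · refine Finset.sum_congr rfl fun i _ => ?_
        congr 2
        ext
        simp only [Fin.val_succ]
        omega
  refine le_antisymm ?_ (csSup_le_csSup' hbdd hsub)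
  refine csSup_le' ?_
  rintro x ⟨𝒜, hk𝒜, h𝒜, rfl⟩
  obtain ⟨ℬ, hℬk, hℬt, hℬs, hmono⟩ := exists_monotone_not_hasRainbowMatching 𝒜 hk𝒜 h𝒜
  have hemb : StrictMono fun i : Fin (s + 1) => (⟨m - (s + 1) + i, by omega⟩ : Fin m) :=
    fun i j hij => by
      rw [Fin.lt_def] at hij ⊢
      simp only
      omega
  refine le_trans ?_ (le_csSup (hbdd.mono hsub)
    ⟨fun i => ℬ ⟨m - (s + 1) + i, by omega⟩, fun i => hℬk _,
      fun i j hij => hmono (hemb.monotone hij), ?_, rfl⟩)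
  · rw [← hℬs, sum_eq_sum_castLE_add_sum (by omega : s ≤ m)]
    refine add_le_add ?_ (le_of_eq ?_)
    · refine (Finset.sum_le_card_nsmul _ _ _ fun i _ => Finset.card_le_card (hmono ?_)).trans_eq
        (by rw [Finset.card_univ, Fintype.card_fin, smul_eq_mul])
      rw [Fin.le_def]
      simp only [Fin.val_castLE, Fin.val_zero]
      omega
    · refine Finset.sum_congr rfl fun i _ => ?_
      congr 2
      ext
      simp only [Fin.val_succ]
      omega
  · rintro ⟨idx, f, hidx, hf, hdisj⟩
    exact hℬt ⟨_, f, hemb.comp hidx, hf, hdisj⟩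
end

section
/- Let n, p, s, k be positive integers with n ≥ 4k²s. Then the maximum of p·|ℬ₀| + |ℬ₁| + … + |ℬ_s| over all nested overlapping sequences ℬ₀ ⊆ ℬ₁ ⊆ … ⊆ ℬ_s of families of k-element subsets of [n] = {1,…,n} equals the maximum over 0 ≤ i ≤ s of (p+s)·C(n,k) − (p+i)·C(n−i,k), where C(a,b) denotes the binomial coefficient. -/
namespace OverlappingFamilies

open Finset

variable {α ι : Type*} [DecidableEq α]

/-- The families `G i`, `i ∈ I`, have pairwise disjoint representatives. -/
def HasRainbow (I : Finset ι) (G : ι → Finset (Finset α)) : Prop :=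
  ∃ f : ι → Finset α, (∀ i ∈ I, f i ∈ G i) ∧ (I : Set ι).PairwiseDisjoint f

/-- The number of members of `G` containing `v`. -/
def deg (G : Finset (Finset α)) (v : α) : ℕ := #{F ∈ G | v ∈ F}

/-- The number of `q`-subsets of an `N`-set that contain a given point. -/
def starCard (N : ℕ) : ℕ → ℕ
  | 0 => 0
  | q + 1 => (N - 1).choose q

lemma starCard_mono {M N : ℕ} (h : M ≤ N) (q : ℕ) : starCard M q ≤ starCard N q := by
  cases q with
  | zero => exact le_rfl
  | succ q => exact Nat.choose_le_choose q (by omega)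

lemma mul_starCard (N q : ℕ) : N * starCard N q = q * N.choose q := by
  cases q with
  | zero => simp [starCard]
  | succ q =>
    cases N with
    | zero => simp
    | succ N =>
      have := Nat.add_one_mul_choose_eq N q
      simp only [starCard, Nat.add_sub_cancel]
      linarith

lemma choose_succ_eq_add_starCard {N : ℕ} (hN : 0 < N) (q : ℕ) :
    N.choose q = (N - 1).choose q + starCard N q := by
  obtain ⟨N, rfl⟩ := Nat.exists_eq_succ_of_ne_zero hN.ne'
  cases q with
  | zero => simp [starCard]
  | succ q => simp [starCard, Nat.choose_succ_succ, add_comm]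

lemma mul_starCard_pred (N q : ℕ) :
    (N - 1) * starCard (N - 1) q = q * starCard N (q + 1) := mul_starCard (N - 1) q

lemma deg_le_starCard {X : Finset α} {G : Finset (Finset α)} {q : ℕ}
    (hG : G ⊆ X.powersetCard q) {v : α} (hv : v ∈ X) : deg G v ≤ starCard #X q := by
  cases q with
  | zero =>
    refine le_of_eq ?_
    rw [deg, starCard, card_eq_zero, filter_eq_empty_iff]
    intro F hF hvF
    have := (mem_powersetCard.1 (hG hF)).2
    rw [card_eq_zero] at this
    simp [this] at hvF
  | succ q =>
    rw [starCard, ← card_erase_of_mem hv, ← card_powersetCard]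
    refine card_le_card_of_injOn (fun F => F.erase v) ?_ ?_
    · intro F hF
      have hF := mem_filter.1 hF
      have h := mem_powersetCard.1 (hG hF.1)
      refine mem_powersetCard.2 ⟨erase_subset_erase _ h.1, ?_⟩
      rw [card_erase_of_mem hF.2, h.2, Nat.add_sub_cancel]
    · intro F hF F' hF' h
      have h1 := insert_erase (mem_filter.1 hF).2
      have h2 := insert_erase (mem_filter.1 hF').2
      rw [← h1, ← h2, show F.erase v = F'.erase v from h]

/-- Sets through `v`, with `v` removed. -/
def link (G : Finset (Finset α)) (v : α) : Finset (Finset α) :=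
  {F ∈ G | v ∈ F}.image (fun F => F.erase v)

lemma card_link (G : Finset (Finset α)) (v : α) : #(link G v) = deg G v := by
  refine card_image_of_injOn ?_
  intro F hF F' hF' h
  have h1 := insert_erase (mem_filter.1 hF).2
  have h2 := insert_erase (mem_filter.1 hF').2
  rw [← h1, ← h2, show F.erase v = F'.erase v from h]

lemma mem_link {G : Finset (Finset α)} {v : α} {A : Finset α} :
    A ∈ link G v ↔ v ∉ A ∧ insert v A ∈ G := by
  simp only [link, mem_image, mem_filter]
  constructor
  · rintro ⟨F, ⟨hF, hv⟩, rfl⟩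
    exact ⟨notMem_erase _ _, by rwa [insert_erase hv]⟩
  · rintro ⟨hv, hA⟩
    exact ⟨insert v A, ⟨hA, mem_insert_self _ _⟩, erase_insert hv⟩

lemma link_subset {X : Finset α} {G : Finset (Finset α)} {q : ℕ}
    (hG : G ⊆ X.powersetCard (q + 1)) (v : α) : link G v ⊆ (X.erase v).powersetCard q := by
  intro A hA
  obtain ⟨hv, hA⟩ := mem_link.1 hA
  obtain ⟨h1, h2⟩ := mem_powersetCard.1 (hG hA)
  rw [card_insert_of_notMem hv] at h2
  refine mem_powersetCard.2 ⟨fun x hx => mem_erase.2 ⟨?_, h1 (mem_insert_of_mem hx)⟩, by omega⟩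
  rintro rfl
  exact hv hx

lemma card_le_sum_deg {G : Finset (Finset α)} {U : Finset α}
    (h : ∀ F ∈ G, ¬ Disjoint F U) : #G ≤ ∑ u ∈ U, deg G u := by
  calc #G ≤ #(U.biUnion fun u => {F ∈ G | u ∈ F}) := by
        refine card_le_card fun F hF => ?_
        obtain ⟨u, huF, huU⟩ := not_disjoint_iff.1 (h F hF)
        exact mem_biUnion.2 ⟨u, huU, mem_filter.2 ⟨hF, huF⟩⟩
    _ ≤ _ := card_biUnion_le

lemma exists_disjoint_of_sum_deg_lt {G : Finset (Finset α)} {U : Finset α}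
    (h : ∑ u ∈ U, deg G u < #G) : ∃ F ∈ G, Disjoint F U := by
  by_contra! hc
  exact absurd (card_le_sum_deg hc) (not_le.2 h)

/-- A star with many members contains a member avoiding a small set. -/
lemma exists_mem_star_disjoint {X : Finset α} {G : Finset (Finset α)} {q : ℕ}
    (hG : G ⊆ X.powersetCard (q + 1)) {v : α} (hv : v ∈ X) {U : Finset α} (hU : U ⊆ X)
    (hvU : v ∉ U) (h : #U * starCard (#X - 1) q < deg G v) :
    ∃ F ∈ G, Disjoint F U := by
  have hs : ∑ u ∈ U, deg (link G v) u ≤ #U * starCard (#X - 1) q := by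
    rw [← smul_eq_mul]
    refine sum_le_card_nsmul _ _ _ fun u hu => ?_
    rw [← card_erase_of_mem hv]
    refine deg_le_starCard (link_subset hG v) (mem_erase.2 ⟨?_, hU hu⟩)
    rintro rfl
    exact hvU hu
  rw [← card_link] at h
  obtain ⟨A, hA, hAU⟩ := exists_disjoint_of_sum_deg_lt (hs.trans_lt h)
  exact ⟨insert v A, (mem_link.1 hA).2, disjoint_insert_left.2 ⟨hvU, hAU⟩⟩

lemma sum_deg_le {X : Finset α} {G : Finset (Finset α)} {r t M : ℕ}
    (hr : #{v ∈ X | t < deg G v} ≤ r) (hM : ∀ v ∈ X, deg G v ≤ M)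
    {U : Finset α} (hU : U ⊆ X) : ∑ u ∈ U, deg G u ≤ r * M + #U * t := by
  rw [← sum_filter_add_sum_filter_not U (fun u => t < deg G u)]
  refine add_le_add ?_ ?_
  · calc _ ≤ #{u ∈ U | t < deg G u} • M :=
          sum_le_card_nsmul _ _ _ fun u hu => hM u (hU (mem_filter.1 hu).1)
      _ ≤ r * M := Nat.mul_le_mul_right _
          ((card_le_card (filter_subset_filter _ hU)).trans hr)
  · calc _ ≤ #{u ∈ U | ¬ t < deg G u} • t :=
          sum_le_card_nsmul _ _ _ fun u hu => not_lt.1 (mem_filter.1 hu).2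
      _ ≤ #U * t := Nat.mul_le_mul_right _ (card_le_card (filter_subset _ _))

lemma exists_distinct_representatives [Nonempty α] [DecidableEq ι] (I : Finset ι)
    (H : ι → Finset α) (h : ∀ i ∈ I, #I ≤ #(H i)) :
    ∃ v : ι → α, Set.InjOn v I ∧ ∀ i ∈ I, v i ∈ H i := by
  induction I using Finset.induction_on with
  | empty => exact ⟨fun _ => Classical.arbitrary α, by simp, by simp⟩
  | insert a I ha ih =>
    rw [card_insert_of_notMem ha] at h
    obtain ⟨v, hv, hvH⟩ := ih fun i hi => (Nat.le_succ _).trans (h i (mem_insert_of_mem hi))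
    obtain ⟨x, hx, hxv⟩ : ∃ x ∈ H a, x ∉ I.image v := exists_mem_notMem_of_card_lt_card
      (card_image_le.trans_lt (h a (mem_insert_self _ _)))
    have hne : ∀ i ∈ I, i ≠ a := by rintro i hi rfl; exact ha hi
    refine ⟨Function.update v a x, ?_, ?_⟩
    · rw [coe_insert, Set.injOn_insert (by exact_mod_cast ha)]
      refine ⟨?_, ?_⟩
      · intro i hi j hj hij
        rw [Function.update_of_ne (hne i hi), Function.update_of_ne (hne j hj)] at hij
        exact hv hi hj hij
      · rintro ⟨i, hi, hix⟩
        rw [Function.update_self, Function.update_of_ne (hne i hi)] at hix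
        exact hxv (mem_image.2 ⟨i, hi, hix⟩)
    · intro i hi
      rcases mem_insert.1 hi with rfl | hi
      · simpa using hx
      · rw [Function.update_of_ne (hne i hi)]
        exact hvH i hi

/-- Extend a rainbow choice by one more set. -/
lemma hasRainbow_of_erase [DecidableEq ι] {I : Finset ι} {G : ι → Finset (Finset α)} {i : ι}
    {f : ι → Finset α} (hf : ∀ j ∈ I.erase i, f j ∈ G j)
    (hd : (I.erase i : Set ι).PairwiseDisjoint f)
    {F : Finset α} (hF : F ∈ G i) (hFd : Disjoint F ((I.erase i).biUnion f)) :
    HasRainbow I G := by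
  rw [disjoint_biUnion_right] at hFd
  refine ⟨Function.update f i F, fun j hj => ?_, fun j hj l hl hjl => ?_⟩
  · by_cases h : j = i
    · subst h; simpa using hF
    · rw [Function.update_of_ne h]; exact hf j (mem_erase.2 ⟨h, hj⟩)
  · simp only [Function.onFun]
    by_cases h : j = i
    · subst h
      rw [Function.update_self, Function.update_of_ne hjl.symm]
      exact hFd l (mem_erase.2 ⟨hjl.symm, hl⟩)
    · rw [Function.update_of_ne h]
      by_cases h' : l = i
      · subst h'
        rw [Function.update_self]
        exact (hFd j (mem_erase.2 ⟨h, hj⟩)).symm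
      · rw [Function.update_of_ne h']
        exact hd (by simp_all) (by simp_all) hjl

lemma card_biUnion_of_uniform {I : Finset ι} {f : ι → Finset α} {q : ℕ}
    (hd : (I : Set ι).PairwiseDisjoint f) (hq : ∀ i ∈ I, #(f i) = q) :
    #(I.biUnion f) = #I * q := by
  rw [card_biUnion fun i hi j hj hij => hd hi hj hij, sum_const_nat hq]

/-- Large families of `q`-sets have pairwise disjoint representatives. -/
def RainbowThreshold (α ι : Type*) [DecidableEq α] (q : ℕ) : Prop :=
  ∀ (r : ℕ) (X : Finset α) (I : Finset ι) (G : ι → Finset (Finset α)),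
    #I = r + 1 → 3 * q ^ 2 * r ≤ #X → (∀ i ∈ I, G i ⊆ X.powersetCard q) →
    (∀ i ∈ I, r * starCard #X q < #(G i)) → HasRainbow I G

lemma hasRainbow_of_stars [DecidableEq ι] {q : ℕ} (hq : RainbowThreshold α ι q)
    {r : ℕ} {X : Finset α}
    {I : Finset ι} {G : ι → Finset (Finset α)} (hI : #I = r + 1)
    (hX : 3 * (q + 1) ^ 2 * r ≤ #X) (hG : ∀ i ∈ I, G i ⊆ X.powersetCard (q + 1))
    {v : ι → α} (hv : Set.InjOn v I) (hvX : ∀ i ∈ I, v i ∈ X)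
    (hdeg : ∀ i ∈ I, 2 * r * starCard (#X - 1) q < deg (G i) (v i)) :
    HasRainbow I G := by
  set V := I.image v with hV
  have hVX : V ⊆ X := by
    intro x hx
    obtain ⟨i, hi, rfl⟩ := mem_image.1 hx
    exact hvX i hi
  have hVc : #V = r + 1 := by rw [hV, card_image_of_injOn hv, hI]
  have hcard : #(X \ V) = #X - (r + 1) := by rw [card_sdiff_of_subset hVX, hVc]
  have hle : starCard #(X \ V) q ≤ starCard (#X - 1) q := starCard_mono (by omega) q
  obtain ⟨f, hf, hd⟩ := hq r (X \ V) I (fun i => {A ∈ link (G i) (v i) | Disjoint A V}) hI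
    (by
      have : r + 1 ≤ #X := hVc ▸ card_le_card hVX
      rw [hcard]
      rcases Nat.eq_zero_or_pos r with rfl | hr
      · simp
      · refine Nat.le_sub_of_add_le (le_trans ?_ hX)
        nlinarith [Nat.zero_le (q * r)])
    (by
      intro i hi A hA
      obtain ⟨hA, hAV⟩ := mem_filter.1 hA
      obtain ⟨h1, h2⟩ := mem_powersetCard.1 (link_subset (hG i hi) _ hA)
      refine mem_powersetCard.2 ⟨fun x hx => mem_sdiff.2 ⟨mem_of_mem_erase (h1 hx), ?_⟩, h2⟩
      exact disjoint_left.1 hAV hx)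
    (by
      intro i hi
      have hsplit := card_filter_add_card_filter_not (s := link (G i) (v i))
        (fun A => Disjoint A V)
      have hbad : #{A ∈ link (G i) (v i) | ¬ Disjoint A V} ≤ r * starCard (#X - 1) q := by
        have hVi : #(V.erase (v i)) = r := by
          rw [card_erase_of_mem (mem_image_of_mem v hi), hVc, Nat.add_sub_cancel]
        have := card_le_sum_deg (G := {A ∈ link (G i) (v i) | ¬ Disjoint A V})
          (U := V.erase (v i)) (by
            intro A hA
            obtain ⟨hA, hAV⟩ := mem_filter.1 hA
            obtain ⟨x, hxA, hxV⟩ := not_disjoint_iff.1 hAV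
            refine not_disjoint_iff.2 ⟨x, hxA, mem_erase.2 ⟨?_, hxV⟩⟩
            rintro rfl
            exact (mem_link.1 hA).1 hxA)
        refine this.trans ?_
        rw [← hVi, ← smul_eq_mul]
        refine sum_le_card_nsmul _ _ _ fun u hu => ?_
        rw [← card_erase_of_mem (hvX i hi)]
        exact deg_le_starCard ((filter_subset _ _).trans (link_subset (hG i hi) _))
          (erase_subset_erase _ hVX hu)
      have h1 := hdeg i hi
      rw [← card_link] at h1
      have h2 := Nat.mul_le_mul_left r hle
      rw [mul_assoc] at h1
      omega)
  refine ⟨fun i => insert (v i) (f i), fun i hi => ?_, fun i hi j hj hij => ?_⟩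
  · exact (mem_link.1 (mem_filter.1 (hf i hi)).1).2
  · have hi' := disjoint_right.1 (mem_filter.1 (hf i hi)).2 (mem_image_of_mem v hj)
    have hj' := disjoint_right.1 (mem_filter.1 (hf j hj)).2 (mem_image_of_mem v hi)
    have hne : v i ≠ v j := fun h => hij (hv hi hj h)
    simp only [Function.onFun, disjoint_insert_left, disjoint_insert_right, mem_insert, not_or]
    exact ⟨⟨hne.symm, hi'⟩, hj', hd hi hj hij⟩

theorem rainbowThreshold (α ι : Type*) [DecidableEq α] [DecidableEq ι] (q : ℕ) :
    RainbowThreshold α ι q := by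
  induction q with
  | zero =>
    intro r X I G _ _ hG hbig
    refine ⟨fun _ => ∅, fun i hi => ?_, fun i _ j _ _ => disjoint_empty_left _⟩
    obtain ⟨F, hF⟩ := card_pos.1 ((Nat.zero_le _).trans_lt (hbig i hi))
    have := (mem_powersetCard.1 (hG i hi hF)).2
    rw [card_eq_zero] at this
    rwa [← this]
  | succ q ihq =>
    intro r
    induction r with
    | zero =>
      intro X I G hI _ _ hbig
      obtain ⟨a, rfl⟩ := card_eq_one.1 hI
      obtain ⟨F, hF⟩ := card_pos.1 ((Nat.zero_le _).trans_lt (hbig a (mem_singleton_self a)))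
      exact ⟨fun _ => F, by simpa using hF, by simp⟩
    | succ r ihr =>
      intro X I G hI hX hG hbig
      have hXpos : 0 < #X := lt_of_lt_of_le (by positivity) hX
      set D := starCard (#X - 1) q with hD
      by_cases hA : ∃ i ∈ I, ∃ v ∈ X, (r + 1) * (q + 1) * D < deg (G i) v
      · obtain ⟨i, hi, v, hv, hdeg⟩ := hA
        have hIi : #(I.erase i) = r + 1 := by rw [card_erase_of_mem hi, hI, Nat.add_sub_cancel]
        have hXv : #(X.erase v) = #X - 1 := card_erase_of_mem hv
        obtain ⟨f, hf, hd⟩ := ihr (X.erase v) (I.erase i) (fun j => {F ∈ G j | v ∉ F}) hIi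
          (by rw [hXv]; refine Nat.le_sub_of_add_le (le_trans ?_ hX); nlinarith)
          (by
            intro j hj F hF
            obtain ⟨hF, hvF⟩ := mem_filter.1 hF
            obtain ⟨h1, h2⟩ := mem_powersetCard.1 (hG j (mem_of_mem_erase hj) hF)
            exact mem_powersetCard.2 ⟨subset_erase.2 ⟨h1, hvF⟩, h2⟩)
          (by
            intro j hj
            have hj := mem_of_mem_erase hj
            have h1 := card_filter_add_card_filter_not (s := G j) (fun F => v ∈ F)
            have h2 : #{F ∈ G j | v ∈ F} ≤ starCard #X (q + 1) := deg_le_starCard (hG j hj) hv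
            have h3 := hbig j hj
            have h4 := Nat.mul_le_mul_left r (starCard_mono (Nat.sub_le #X 1) (q + 1))
            rw [hXv]
            rw [add_mul, one_mul] at h3
            omega)
        have hf' : ∀ j ∈ I.erase i, f j ∈ G j := fun j hj => (mem_filter.1 (hf j hj)).1
        have hfX := fun j hj => mem_powersetCard.1 (hG j (mem_of_mem_erase hj) (hf' j hj))
        have hU := card_biUnion_of_uniform hd (fun j hj => (hfX j hj).2)
        obtain ⟨F, hF, hFU⟩ := exists_mem_star_disjoint (hG i hi) hv
          (U := (I.erase i).biUnion f) (biUnion_subset.2 fun j hj => (hfX j hj).1)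
          (by
            simp only [mem_biUnion, not_exists, not_and]
            exact fun j hj => (mem_filter.1 (hf j hj)).2)
          (by rw [hU, hIi]; exact hdeg)
        exact hasRainbow_of_erase hf' hd hF hFU
      push Not at hA
      by_cases hB : ∃ i ∈ I, #{v ∈ X | 2 * (r + 1) * D < deg (G i) v} ≤ r + 1
      · obtain ⟨i, hi, hhigh⟩ := hB
        have hIi : #(I.erase i) = r + 1 := by rw [card_erase_of_mem hi, hI, Nat.add_sub_cancel]
        obtain ⟨f, hf, hd⟩ := ihr X (I.erase i) G hIi
          (le_trans (Nat.mul_le_mul_left _ r.le_succ) hX)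
          (fun j hj => hG j (mem_of_mem_erase hj))
          (fun j hj => (Nat.mul_le_mul_right _ r.le_succ).trans_lt
            (hbig j (mem_of_mem_erase hj)))
        have hfX := fun j hj => mem_powersetCard.1 (hG j (mem_of_mem_erase hj) (hf j hj))
        have hU := card_biUnion_of_uniform hd (fun j hj => (hfX j hj).2)
        have hsum := sum_deg_le hhigh (hA i hi) (U := (I.erase i).biUnion f)
          (biUnion_subset.2 fun j hj => (hfX j hj).1)
        have hD3 : 3 * (r + 1) * (q + 1) * D ≤ starCard #X (q + 1) := by
          rcases Nat.eq_zero_or_pos q with rfl | hqpos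
          · simp [hD, starCard]
          have h1 := mul_starCard_pred #X q
          have h2 : 3 * (r + 1) * (q + 1) * q ≤ #X - 1 := by
            refine Nat.le_sub_of_add_le (le_trans ?_ hX)
            nlinarith
          have h3 : 0 < #X - 1 := lt_of_lt_of_le (by positivity) h2
          refine Nat.le_of_mul_le_mul_left ?_ h3
          calc (#X - 1) * (3 * (r + 1) * (q + 1) * D)
              = 3 * (r + 1) * (q + 1) * ((#X - 1) * D) := by ring
            _ = 3 * (r + 1) * (q + 1) * q * starCard #X (q + 1) := by rw [hD, h1]; ring
            _ ≤ _ := Nat.mul_le_mul_right _ h2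
        obtain ⟨F, hF, hFU⟩ := exists_disjoint_of_sum_deg_lt (G := G i)
          (U := (I.erase i).biUnion f) (by
            refine lt_of_le_of_lt hsum (lt_of_le_of_lt ?_ (hbig i hi))
            rw [hU, hIi]
            calc _ = (r + 1) * (3 * (r + 1) * (q + 1) * D) := by ring
              _ ≤ _ := Nat.mul_le_mul_left _ hD3)
        exact hasRainbow_of_erase hf hd hF hFU
      push Not at hB
      have : Nonempty α := ⟨(card_pos.1 hXpos).choose⟩
      obtain ⟨v, hv, hvH⟩ := exists_distinct_representatives I
        (fun i => {v ∈ X | 2 * (r + 1) * D < deg (G i) v})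
        (fun i hi => by rw [hI]; exact hB i hi)
      exact hasRainbow_of_stars ihq hI hX hG hv (fun i hi => (mem_filter.1 (hvH i hi)).1)
        (fun i hi => (mem_filter.1 (hvH i hi)).2)

lemma choose_sub_succ_mul {n s : ℕ} (hs : s + 1 ≤ n) (k : ℕ) :
    (n - (s + 1)).choose k * (n - s) = (n - s).choose k * (n - s - k) := by
  obtain ⟨m, hm⟩ : ∃ m, n - s = m + 1 := ⟨n - s - 1, by omega⟩
  have h1 : n - (s + 1) = m := by omega
  rw [h1, hm]
  exact Nat.choose_mul_succ_eq m k

lemma add_mul_choose_sub_le (n k s : ℕ) (h : k + s ≤ n) :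
    (n + k * s) * (n - s).choose k ≤ n * n.choose k := by
  induction s with
  | zero => simp
  | succ s ih =>
    refine le_trans ?_ (ih (by omega))
    have h1 := choose_sub_succ_mul (n := n) (s := s) (by omega) k
    obtain ⟨a, ha⟩ : ∃ a, n - s = k + a := ⟨n - s - k, by omega⟩
    rw [ha, Nat.add_sub_cancel_left] at h1
    rw [ha]
    refine Nat.le_of_mul_le_mul_right ?_ (show 0 < k + a by omega)
    have hn : n = s + k + a := by omega
    calc (n + k * (s + 1)) * (n - (s + 1)).choose k * (k + a)
        = (n + k * (s + 1)) * a * (k + a).choose k := by rw [mul_assoc, h1]; ring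
      _ ≤ (n + k * s) * (k + a) * (k + a).choose k := by
          refine Nat.mul_le_mul_right _ ?_
          subst hn
          nlinarith [Nat.zero_le (k * s), Nat.zero_le (k * k)]
      _ = _ := by ring

lemma mul_choose_le_add_mul_choose_sub (n k r i : ℕ) (h : k * (r + i) + i ≤ n) :
    r * n.choose k ≤ (r + i) * (n - i).choose k := by
  induction i with
  | zero => simp
  | succ i ih =>
    refine (ih (by nlinarith)).trans ?_
    rcases Nat.eq_zero_or_pos k with rfl | hk
    · simp
    have hki : k + i ≤ n := by nlinarith [Nat.zero_le (k * (r + i))]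
    have h1 := choose_sub_succ_mul (n := n) (s := i) (by nlinarith) k
    obtain ⟨a, ha⟩ : ∃ a, n - i = k + a := ⟨n - i - k, by omega⟩
    rw [ha, Nat.add_sub_cancel_left] at h1
    rw [ha]
    refine Nat.le_of_mul_le_mul_right ?_ (show 0 < k + a by omega)
    have hn : n = i + k + a := by omega
    calc (r + i) * (k + a).choose k * (k + a)
        = (r + i) * (k + a) * (k + a).choose k := by ring
      _ ≤ (r + (i + 1)) * a * (k + a).choose k := by
          refine Nat.mul_le_mul_right _ ?_
          subst hn
          nlinarith
      _ = (r + (i + 1)) * (n - (i + 1)).choose k * (k + a) := by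
          rw [mul_assoc _ _ (k + a), h1]; ring

lemma mul_choose_le_mul_choose_sub_add {n k u : ℕ} (hu : u ≤ n) :
    n * n.choose k ≤ n * (n - u).choose k + u * k * n.choose k := by
  induction u with
  | zero => simp
  | succ u ih =>
    have h1 := choose_succ_eq_add_starCard (N := n - u) (by omega) k
    have h2 := starCard_mono (Nat.sub_le n u) k
    have h3 := mul_starCard n k
    have h4 := ih (by omega)
    rw [Nat.sub_sub] at h1
    rw [h1] at h4
    nlinarith

lemma exists_index_of_bounds {n p s k r b S D : ℕ} (hk : 0 < k) (hr : 0 < r) (hrs : r ≤ s)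
    (hn : 4 * k ^ 2 * s ≤ n) (hD : D = starCard (n - 1) (k - 1))
    (hb : b ≤ r * (k * s * D) + r * k * (2 * r * D))
    (hS : S + r * (n - r * k).choose k ≤ s * n.choose k) :
    ∃ i ≤ s, (p + i) * (n - i).choose k + (p * b + S) ≤ (p + s) * n.choose k := by
  have hs : 0 < s := hr.trans_le hrs
  have hks : 4 * (k * s) ≤ n := by nlinarith [Nat.mul_le_mul_left (k * s) hk]
  have hrk : r * k ≤ k * s := by nlinarith
  have hk4 : 4 * k ≤ n := by nlinarith
  have hsn : 4 * s ≤ n := by nlinarith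
  have hn0 : 0 < n := by omega
  set C := n.choose k with hC
  have hDC : n ^ 2 * D ≤ k ^ 2 * C := by
    obtain ⟨q, rfl⟩ : ∃ q, k = q + 1 := ⟨k - 1, by omega⟩
    obtain ⟨m, rfl⟩ : ∃ m, n = m + 1 := ⟨n - 1, by omega⟩
    have h1 := mul_starCard_pred (m + 1) q
    have h2 := mul_starCard (m + 1) (q + 1)
    simp only [Nat.add_sub_cancel] at h1 hD
    rw [← hD] at h1
    rw [← hC] at h2
    refine Nat.le_of_mul_le_mul_left ?_ (show 0 < m by omega)
    calc m * ((m + 1) ^ 2 * D) = (m + 1) * ((m + 1) * (m * D)) := by ring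
      _ = (m + 1) * q * ((m + 1) * starCard (m + 1) (q + 1)) := by rw [h1]; ring
      _ = (m + 1) * q * (q + 1) * C := by rw [h2]; ring
      _ ≤ m * (q + 1) * (q + 1) * C := by
          refine Nat.mul_le_mul_right _ (Nat.mul_le_mul_right _ ?_)
          nlinarith
      _ = _ := by ring
  have hnb : n ^ 2 * b ≤ r * k ^ 3 * (s + 2 * r) * C := by
    calc n ^ 2 * b ≤ n ^ 2 * (r * (k * s * D) + r * k * (2 * r * D)) :=
          Nat.mul_le_mul_left _ hb
      _ = r * k * (s + 2 * r) * (n ^ 2 * D) := by ring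
      _ ≤ r * k * (s + 2 * r) * (k ^ 2 * C) := Nat.mul_le_mul_left _ hDC
      _ = _ := by ring
  have hgain := mul_choose_le_mul_choose_sub_add (n := n) (k := k) (u := r * k) (by omega)
  rw [← hC] at hgain
  have hmain : n * b + k * S ≤ k * s * C := by
    refine Nat.le_of_mul_le_mul_left ?_ hn0
    have h1 : k ^ 2 * (s + 3 * r) ≤ n := le_trans (by nlinarith) hn
    have h2 := Nat.mul_le_mul_left (k * r * C) h1
    have h3 := Nat.mul_le_mul_left (k * r) hgain
    have h4 := Nat.mul_le_mul_left (k * n) hS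
    linarith
  rcases le_total (k * p) n with hp | hp
  · refine ⟨0, Nat.zero_le _, Nat.le_of_mul_le_mul_left ?_ hk⟩
    have := Nat.mul_le_mul_right b hp
    rw [Nat.add_zero, Nat.sub_zero, ← hC]
    linarith
  · refine ⟨s, le_rfl, Nat.le_of_mul_le_mul_left ?_ hk⟩
    obtain ⟨d, hd⟩ := Nat.exists_eq_add_of_le hp
    set T := (n - s).choose k with hT
    have hTn := add_mul_choose_sub_le n k s (by omega)
    rw [← hT, ← hC] at hTn
    have hTb : T + b ≤ C := by
      refine Nat.le_of_mul_le_mul_left ?_ (show 0 < (n + k * s) * n ^ 2 by positivity)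
      have h1 : r * k ^ 3 * (s + 2 * r) ≤ 3 * s ^ 2 * k ^ 3 := by
        have : r * (s + 2 * r) ≤ s * (s + 2 * s) := Nat.mul_le_mul hrs (by omega)
        nlinarith [Nat.mul_le_mul_right (k ^ 3) this]
      have h2 : 3 * (s * k ^ 2) * (n + k * s) ≤ n ^ 2 := by
        nlinarith [Nat.mul_le_mul hn (show 4 * n + 4 * (k * s) ≤ 5 * n by omega)]
      have h3 := Nat.mul_le_mul_left (k * s * C) h2
      have h4 := Nat.mul_le_mul_left (n + k * s) (hnb.trans (Nat.mul_le_mul_right C h1))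
      have h5 := Nat.mul_le_mul_left (n ^ 2) hTn
      linarith
    have h6 := Nat.mul_le_mul_left d hTb
    calc k * ((p + s) * T + (p * b + S))
        = (k * p) * T + k * s * T + (k * p) * b + k * S := by ring
      _ ≤ (k * p) * C + k * s * C := by rw [hd]; linarith
      _ = _ := by ring

lemma card_le_card_filter_disjoint_add {X : Finset α} {G : Finset (Finset α)} {k : ℕ}
    (hG : G ⊆ X.powersetCard k) {U : Finset α} (hU : U ⊆ X) :
    #G + (#X - #U).choose k ≤ #{F ∈ G | Disjoint F U} + (#X).choose k := by
  rw [← card_sdiff_of_subset hU, ← card_powersetCard, ← card_powersetCard,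
    ← card_filter_add_card_filter_not (s := G) (fun F => Disjoint F U), add_assoc,
    Nat.add_le_add_iff_left, ← card_union_of_disjoint]
  · refine card_le_card (union_subset ((filter_subset _ _).trans hG)
      (powersetCard_mono sdiff_subset))
  · rw [disjoint_left]
    intro F hF hF'
    refine (mem_filter.1 hF).2 (disjoint_left.2 fun x hx => ?_)
    exact (mem_sdiff.1 ((mem_powersetCard.1 hF').1 hx)).2

lemma card_le_card_filter_notMem_add {X : Finset α} {G : Finset (Finset α)} {k : ℕ}
    (hG : G ⊆ X.powersetCard k) {v : α} (hv : v ∈ X) :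
    #G ≤ #{F ∈ G | v ∉ F} + starCard #X k := by
  have h1 := card_filter_add_card_filter_not (s := G) (fun F => v ∈ F)
  have h2 : #{F ∈ G | v ∈ F} ≤ starCard #X k := deg_le_starCard hG hv
  omega

/-- If the first family has a vertex of large degree, delete this family and this vertex. -/
lemma not_hasRainbow_of_deg_lt {X : Finset α} {k s : ℕ} {B : ℕ → Finset (Finset α)}
    (hB : ∀ j ≤ s + 1, B j ⊆ X.powersetCard (k + 1)) (hno : ¬ HasRainbow (range (s + 2)) B)
    {v : α} (hv : v ∈ X) (hdeg : (k + 1) * (s + 1) * starCard (#X - 1) k < deg (B 0) v) :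
    ¬ HasRainbow (range (s + 1)) (fun j => {F ∈ B (j + 1) | v ∉ F}) := by
  rintro ⟨f, hf, hd⟩
  have hfX : ∀ j ∈ range (s + 1), f j ⊆ X ∧ #(f j) = k + 1 := fun j hj =>
    mem_powersetCard.1 (hB (j + 1) (by simp at hj; omega) (mem_filter.1 (hf j hj)).1)
  have hU := card_biUnion_of_uniform hd fun j hj => (hfX j hj).2
  obtain ⟨F, hF, hFU⟩ := exists_mem_star_disjoint (hB 0 (Nat.zero_le _)) hv
    (U := (range (s + 1)).biUnion f) (biUnion_subset.2 fun j hj => (hfX j hj).1)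
    (by
      simp only [mem_biUnion, not_exists, not_and]
      exact fun j hj => (mem_filter.1 (hf j hj)).2)
    (by rwa [hU, card_range, mul_comm (s + 1)])
  rw [disjoint_biUnion_right] at hFU
  refine hno ⟨fun j => Nat.casesOn j F f, ?_, ?_⟩
  · rintro (_ | j) hj
    · exact hF
    · exact (mem_filter.1 (hf j (by simpa using hj))).1
  · rintro (_ | i) hi (_ | j) hj hij
    · exact absurd rfl hij
    · exact hFU j (by simpa using hj)
    · exact (hFU i (by simpa using hi)).symm
    · exact hd (by simpa using hi) (by simpa using hj) (by simpa using hij)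

/-- If the first families have disjoint representatives with union `U`, delete these families and
the points of `U`. -/
lemma not_hasRainbow_of_disjoint {s r : ℕ} (hrs : r ≤ s) {B : ℕ → Finset (Finset α)}
    (hno : ¬ HasRainbow (range (s + 1)) B) {f : ℕ → Finset α} (hf : ∀ j ∈ range r, f j ∈ B j)
    (hd : (range r : Set ℕ).PairwiseDisjoint f) :
    ¬ HasRainbow (range (s - r + 1))
      (fun j => {F ∈ B (r + j) | Disjoint F ((range r).biUnion f)}) := by
  rintro ⟨g, hg, hgd⟩
  have key : ∀ i < r, ∀ j, r ≤ j → j ≤ s → Disjoint (f i) (g (j - r)) := by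
    intro i hi j hj hjs
    have h := (mem_filter.1 (hg (j - r) (by simp; omega))).2
    rw [disjoint_biUnion_right] at h
    exact (h i (by simpa using hi)).symm
  refine hno ⟨fun j => if j < r then f j else g (j - r), fun j hj => ?_, fun i hi j hj hij => ?_⟩
  · by_cases h : j < r
    · simpa only [h, if_true] using hf j (by simpa using h)
    · have := (mem_filter.1 (hg (j - r) (by simp at hj ⊢; omega))).1
      rw [Nat.add_sub_cancel' (not_lt.1 h)] at this
      simpa only [h, if_false] using this
  · have hi : i ≤ s := by simpa [Nat.lt_succ_iff] using hi
    have hj : j ≤ s := by simpa [Nat.lt_succ_iff] using hj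
    by_cases h : i < r <;> by_cases h' : j < r <;>
      simp only [Function.onFun, h, h', if_true, if_false]
    · exact hd (by simpa using h) (by simpa using h') hij
    · exact key i h j (not_lt.1 h') hj
    · exact (key j h' i (not_lt.1 h) hi).symm
    · exact hgd (by simp; omega) (by simp; omega) (by omega)

/-- If `G` has no `r + 1` disjoint members, then it has few vertices of large degree. -/
lemma card_high_le {X : Finset α} {G : Finset (Finset α)} {q r : ℕ}
    (hG : G ⊆ X.powersetCard (q + 1)) (hX : 3 * (q + 1) ^ 2 * r ≤ #X)
    (hno : ¬ HasRainbow (range (r + 1)) (fun _ => G)) :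
    #{v ∈ X | 2 * r * starCard (#X - 1) q < deg G v} ≤ r := by
  by_contra! h
  obtain ⟨x, -⟩ := card_pos.1 ((Nat.zero_le _).trans_lt h)
  have : Nonempty α := ⟨x⟩
  obtain ⟨v, hv, hvH⟩ := exists_distinct_representatives (range (r + 1))
    (fun _ => {v ∈ X | 2 * r * starCard (#X - 1) q < deg G v})
    (fun i _ => by rw [card_range]; exact h)
  exact hno (hasRainbow_of_stars (rainbowThreshold α ℕ q) (card_range _) hX (fun _ _ => hG) hv
    (fun i hi => (mem_filter.1 (hvH i hi)).1) (fun i hi => (mem_filter.1 (hvH i hi)).2))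

lemma card_le_of_maximal_matching {X : Finset α} {G : Finset (Finset α)} {q r M : ℕ}
    (hG : G ⊆ X.powersetCard (q + 1)) (hX : 3 * (q + 1) ^ 2 * r ≤ #X)
    (hno : ¬ HasRainbow (range (r + 1)) (fun _ => G)) (hM : ∀ v ∈ X, deg G v ≤ M)
    {f : ℕ → Finset α} (hf : ∀ j ∈ range r, f j ∈ G)
    (hd : (range r : Set ℕ).PairwiseDisjoint f) :
    #G ≤ r * M + r * (q + 1) * (2 * r * starCard (#X - 1) q) := by
  have hfX := fun j hj => mem_powersetCard.1 (hG (hf j hj))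
  have hU := card_biUnion_of_uniform hd fun j hj => (hfX j hj).2
  rw [card_range] at hU
  have herase : (range (r + 1)).erase r = range r := by
    rw [range_add_one, erase_insert notMem_range_self]
  have hmeet : ∀ F ∈ G, ¬ Disjoint F ((range r).biUnion f) := by
    intro F hF hFU
    refine hno (hasRainbow_of_erase (i := r) (f := f) (F := F) ?_ ?_ hF ?_)
    · rwa [herase]
    · rwa [herase]
    · rwa [herase]
  have hsum := sum_deg_le (card_high_le hG hX hno) hM (U := (range r).biUnion f)
    (biUnion_subset.2 fun j hj => (hfX j hj).1)
  rw [hU] at hsum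
  exact (card_le_sum_deg hmeet).trans hsum

/-- Nested overlapping families: if the first one has `r` disjoint members, then the other families
miss many sets. -/
lemma sum_card_add_le {X : Finset α} {k s r : ℕ} {B : ℕ → Finset (Finset α)}
    (hrs : r ≤ s) (hB : ∀ j ≤ s, B j ⊆ X.powersetCard k)
    (hmono : ∀ i j, i ≤ j → j ≤ s → B i ⊆ B j) {U : Finset α} (hU : U ⊆ X)
    (hbound : r * (#X - #U).choose k + (r * #{F ∈ B r | Disjoint F U} +
      ∑ j ∈ range (s - r), #{F ∈ B (r + (j + 1)) | Disjoint F U}) ≤ s * (#X - #U).choose k) :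
    ∑ j ∈ range s, #(B (j + 1)) + r * (#X - #U).choose k ≤ s * (#X).choose k := by
  obtain ⟨t, rfl⟩ := Nat.exists_eq_add_of_le hrs
  rw [Nat.add_sub_cancel_left] at hbound
  have h1 : ∑ j ∈ range r, #(B (j + 1)) ≤ r * #(B r) := by
    refine (sum_le_card_nsmul _ _ #(B r) fun j hj => ?_).trans (by simp)
    exact card_le_card (hmono _ _ (by simpa using hj) (by omega))
  have h2 := card_le_card_filter_disjoint_add (hB r (by omega)) hU
  have h3 : ∑ j ∈ range t, #(B (r + j + 1)) + t * (#X - #U).choose k ≤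
      ∑ j ∈ range t, #{F ∈ B (r + (j + 1)) | Disjoint F U} + t * (#X).choose k := by
    have := sum_le_sum fun j (hj : j ∈ range t) =>
      card_le_card_filter_disjoint_add (hB (r + (j + 1)) (by simp at hj; omega)) hU
    simpa [sum_add_distrib, add_assoc] using this
  rw [sum_range_add]
  nlinarith [Nat.mul_le_mul_left r h2]

/-- The upper bound for nested overlapping families. -/
theorem exists_index_weight_le {k : ℕ} (hk : 0 < k) (s : ℕ) :
    ∀ (X : Finset α) (p : ℕ) (B : ℕ → Finset (Finset α)), 4 * k ^ 2 * s ≤ #X →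
      (∀ j ≤ s, B j ⊆ X.powersetCard k) → (∀ i j, i ≤ j → j ≤ s → B i ⊆ B j) →
      ¬ HasRainbow (range (s + 1)) B →
      ∃ i ≤ s, (p + i) * (#X - i).choose k + (p * #(B 0) + ∑ j ∈ range s, #(B (j + 1))) ≤
        (p + s) * (#X).choose k := by
  induction s using Nat.strong_induction_on with
  | _ s ih =>
  intro X p B hX hB hmono hno
  by_cases hB0 : B 0 = ∅
  · refine ⟨0, Nat.zero_le _, ?_⟩
    have : ∑ j ∈ range s, #(B (j + 1)) ≤ s * (#X).choose k := by
      refine (sum_le_card_nsmul _ _ ((#X).choose k) fun j hj => ?_).trans (by simp)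
      rw [← card_powersetCard]
      exact card_le_card (hB _ (by simpa using hj))
    simp only [hB0, card_empty, Nat.sub_zero]
    linarith
  obtain ⟨F₀, hF₀⟩ := nonempty_iff_ne_empty.2 hB0
  obtain ⟨q, rfl⟩ : ∃ q, k = q + 1 := ⟨k - 1, by omega⟩
  rcases s with _ | s
  · exact absurd ⟨fun _ => F₀, by simpa using hF₀, by simp⟩ hno
  have hXpos : 0 < #X := lt_of_lt_of_le (by positivity) hX
  by_cases hdeg : ∃ v ∈ X, (q + 1) * (s + 1) * starCard (#X - 1) q < deg (B 0) v
  · obtain ⟨v, hv, hdeg⟩ := hdeg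
    have hXv : #(X.erase v) = #X - 1 := card_erase_of_mem hv
    obtain ⟨i, hi, hw⟩ := ih s s.lt_succ_self (X.erase v) (p + 1)
      (fun j => {F ∈ B (j + 1) | v ∉ F})
      (by rw [hXv]; refine Nat.le_sub_of_add_le (le_trans ?_ hX); nlinarith)
      (by
        intro j hj F hF
        obtain ⟨hF, hvF⟩ := mem_filter.1 hF
        obtain ⟨h1, h2⟩ := mem_powersetCard.1 (hB (j + 1) (by omega) hF)
        exact mem_powersetCard.2 ⟨subset_erase.2 ⟨h1, hvF⟩, h2⟩)
      (fun i j hij hj => filter_subset_filter _ (hmono _ _ (by omega) (by omega)))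
      (not_hasRainbow_of_deg_lt hB hno hv hdeg)
    refine ⟨i + 1, by omega, ?_⟩
    rw [hXv] at hw
    have h0 := card_le_card (hmono 0 1 (by omega) (by omega))
    have h1 := card_le_card_filter_notMem_add (hB 1 (by omega)) hv
    have hsum : ∑ j ∈ range s, #(B (j + 1 + 1)) ≤
        ∑ j ∈ range s, #{F ∈ B (j + 1 + 1) | v ∉ F} + s * starCard #X (q + 1) := by
      have := sum_le_sum fun j (hj : j ∈ range s) =>
        card_le_card_filter_notMem_add (hB (j + 1 + 1) (by simp at hj; omega)) hv
      simpa [sum_add_distrib] using this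
    rw [sum_range_succ', choose_succ_eq_add_starCard hXpos (q + 1),
      show #X - (i + 1) = #X - 1 - i by omega]
    nlinarith [Nat.mul_le_mul_left p (h0.trans h1)]
  push Not at hdeg
  have hnos : ¬ HasRainbow (range (s + 1 + 1)) (fun _ => B 0) :=
    fun ⟨f, hf, hd⟩ => hno ⟨f, fun j hj => hmono 0 j (Nat.zero_le _)
      (by simpa [Nat.lt_succ_iff] using hj) (hf j hj), hd⟩
  have hex : ∃ r, ¬ HasRainbow (range (r + 1)) (fun _ => B 0) := ⟨s + 1, hnos⟩
  classical
  obtain ⟨r, hr, hrs, hrno, f, hf, hd⟩ : ∃ r, 0 < r ∧ r ≤ s + 1 ∧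
      ¬ HasRainbow (range (r + 1)) (fun _ => B 0) ∧ HasRainbow (range r) (fun _ => B 0) := by
    have h0 : 0 < Nat.find hex := by
      rw [Nat.find_pos, not_not]
      exact ⟨fun _ => F₀, by simpa using hF₀, by simp⟩
    refine ⟨Nat.find hex, h0, Nat.find_min' hex hnos, Nat.find_spec hex, ?_⟩
    have := Nat.find_min hex (Nat.sub_lt h0 one_pos)
    rwa [not_not, Nat.sub_add_cancel (show 1 ≤ Nat.find hex from h0)] at this
  have hfX := fun j hj => mem_powersetCard.1 (hB 0 (Nat.zero_le _) (hf j hj))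
  set U := (range r).biUnion f with hUdef
  have hU : #U = r * (q + 1) := by
    rw [hUdef, card_biUnion_of_uniform hd fun j hj => (hfX j hj).2, card_range]
  have hUX : U ⊆ X := biUnion_subset.2 fun j hj => (hfX j hj).1
  have hb := card_le_of_maximal_matching (hB 0 (Nat.zero_le _))
    (le_trans (by nlinarith [Nat.mul_le_mul_left ((q + 1) ^ 2) hrs]) hX) hrno hdeg hf hd
  have hrq : r * (q + 1) ≤ (q + 1) * (s + 1) := by nlinarith
  have hXq : 4 * ((q + 1) * (s + 1)) ≤ #X := by
    nlinarith [Nat.mul_le_mul_left ((q + 1) * (s + 1)) hk]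
  obtain ⟨i, hi, hw⟩ := ih (s + 1 - r) (by omega) (X \ U) r
    (fun j => {F ∈ B (r + j) | Disjoint F U})
    (by
      rw [card_sdiff_of_subset hUX, hU]
      obtain ⟨t, ht⟩ := Nat.exists_eq_add_of_le hrs
      rw [ht, Nat.add_sub_cancel_left]
      rw [ht] at hX
      refine Nat.le_sub_of_add_le (le_trans ?_ hX)
      nlinarith [Nat.zero_le (r * q), Nat.zero_le (r * q ^ 2)])
    (by
      intro j hj F hF
      obtain ⟨hF, hFU⟩ := mem_filter.1 hF
      obtain ⟨h1, h2⟩ := mem_powersetCard.1 (hB (r + j) (by omega) hF)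
      exact mem_powersetCard.2
        ⟨fun x hx => mem_sdiff.2 ⟨h1 hx, disjoint_left.1 hFU hx⟩, h2⟩)
    (fun i j hij hj => filter_subset_filter _ (hmono _ _ (by omega) (by omega)))
    (not_hasRainbow_of_disjoint hrs hno
      (fun j hj => hmono 0 j (Nat.zero_le _) (by simp at hj; omega) (hf j hj)) hd)
  rw [card_sdiff_of_subset hUX] at hw
  have hri := mul_choose_le_add_mul_choose_sub (#X - #U) (q + 1) r i (by
    have h1 : (q + 1) * (r + i) ≤ (q + 1) * (s + 1) := Nat.mul_le_mul_left _ (by omega)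
    have h2 : s + 1 ≤ (q + 1) * (s + 1) := Nat.le_mul_of_pos_left _ hk
    rw [hU]
    omega)
  have hS := sum_card_add_le hrs hB hmono hUX (by
    rw [Nat.add_sub_cancel' hrs] at hw
    exact (Nat.add_le_add_right hri _).trans hw)
  rw [hU] at hS
  exact exists_index_of_bounds hk hr hrs hX rfl hb hS

/-- The `k`-subsets of `Fin n` that contain an element less than `i`. -/
def meetInitial (n k i : ℕ) : Finset (Finset (Fin n)) :=
  {F ∈ univ.powersetCard k | ∃ x ∈ F, (x : ℕ) < i}

lemma card_meetInitial_add {n i : ℕ} (hi : i ≤ n) (k : ℕ) :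
    #(meetInitial n k i) + (n - i).choose k = n.choose k := by
  have h1 := card_filter_add_card_filter_not (s := (univ : Finset (Fin n)).powersetCard k)
    (fun F => ∃ x ∈ F, (x : ℕ) < i)
  have h2 : {F ∈ (univ : Finset (Fin n)).powersetCard k |
        ¬ ∃ x ∈ (F : Finset (Fin n)), (x : ℕ) < i} =
      ({x | ¬ (x : ℕ) < i} : Finset (Fin n)).powersetCard k := by
    ext F
    simp only [mem_filter, mem_powersetCard, true_and, not_exists, not_and,
      subset_iff, mem_univ]
    tauto
  have h3 := card_filter_add_card_filter_not (s := (univ : Finset (Fin n))) (fun x => (x : ℕ) < i)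
  have h4 : #({x | (x : ℕ) < i} : Finset (Fin n)) = i := by
    rw [Fin.card_filter_val_lt, min_eq_right hi]
  rw [h4, card_univ, Fintype.card_fin] at h3
  rw [h2, card_powersetCard, card_powersetCard, card_univ, Fintype.card_fin] at h1
  rw [show n - i = #({x | ¬ (x : ℕ) < i} : Finset (Fin n)) by omega]
  exact h1

/-- The extremal construction: the families of index at most `i` consist of the sets meeting the
first `i` points, and the other families are complete. -/
def extremal (n k s i : ℕ) (j : Fin (s + 1)) : Finset (Finset (Fin n)) :=
  if (j : ℕ) ≤ i then meetInitial n k i else univ.powersetCard k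

lemma strictMono_fin_eq {m : ℕ} {idx : Fin m → Fin m} (h : StrictMono idx) (a : Fin m) :
    idx a = a := by
  have hr : Set.range idx = Set.range (id : Fin m → Fin m) := by
    rw [Set.range_id]
    exact (Finite.injective_iff_surjective.1 h.injective).range_eq
  exact congrFun ((h.range_inj strictMono_id).1 hr) a

lemma not_hasRainbowMatching_extremal {n k s i : ℕ} (hi : i ≤ s) :
    ¬ HasRainbowMatching (extremal n k s i) (s + 1) := by
  rintro ⟨idx, f, hidx, hf, hd⟩
  have hex : ∀ a : Fin (i + 1), ∃ x ∈ f (Fin.castLE (by omega) a), (x : ℕ) < i := by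
    intro a
    have h := hf (Fin.castLE (by omega) a)
    rw [strictMono_fin_eq hidx, extremal, if_pos (by simp; omega)] at h
    exact (mem_filter.1 h).2
  choose x hx hxi using hex
  have hinj : Function.Injective fun a => (⟨x a, hxi a⟩ : Fin i) := by
    intro a b hab
    by_contra hne
    have hxx : x a = x b := Fin.ext (by simpa using hab)
    refine disjoint_left.1 (hd _ _ ?_) (hx a) (hxx ▸ hx b)
    simpa using hne
  have := Fintype.card_le_of_injective _ hinj
  simp at this

lemma weight_extremal {n i s : ℕ} (hi : i ≤ s) (hin : i ≤ n) (p k : ℕ) :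
    p * #(extremal n k s i 0) + ∑ j : Fin s, #(extremal n k s i j.succ) =
      (p + s) * n.choose k - (p + i) * (n - i).choose k := by
  have h1 := card_meetInitial_add hin k
  have h2 : ∑ j : Fin s, #(extremal n k s i j.succ) =
      ∑ j ∈ range s, if j + 1 ≤ i then #(meetInitial n k i) else n.choose k := by
    rw [← Fin.sum_univ_eq_sum_range
      (fun j => if j + 1 ≤ i then #(meetInitial n k i) else n.choose k)]
    refine sum_congr rfl fun j _ => ?_
    rw [extremal, apply_ite card, card_powersetCard, card_univ, Fintype.card_fin, Fin.val_succ]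
  obtain ⟨t, rfl⟩ := Nat.exists_eq_add_of_le hi
  have h3 : ∑ j ∈ range i, (if j + 1 ≤ i then #(meetInitial n k i) else n.choose k) =
      i * #(meetInitial n k i) := by
    rw [sum_congr rfl fun j hj => if_pos (by simpa using hj), sum_const, card_range, smul_eq_mul]
  have h4 : ∑ j ∈ range t, (if i + j + 1 ≤ i then #(meetInitial n k i) else n.choose k) =
      t * n.choose k := by
    rw [sum_congr rfl fun j _ => if_neg (by omega), sum_const, card_range, smul_eq_mul]
  rw [h2, sum_range_add, h3, h4, extremal, if_pos (by simp), ← h1]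
  refine (Nat.sub_eq_of_eq_add ?_).symm
  ring

end OverlappingFamilies

/-- Lemma 3.1: for `n ≥ 4k²s`, the maximum of `p|ℬ₀| + |ℬ₁| + … + |ℬ_s|` over
nested overlapping families of `k`-subsets of `[n]` equals
`max_{0 ≤ i ≤ s} ((p+s)·C(n,k) − (p+i)·C(n−i,k))`. -/
theorem stmt6 (n p s k : ℕ) (hk : 0 < k) (hs : 0 < s) (hp : 0 < p)
    (hn : 4 * k ^ 2 * s ≤ n) :
    IsGreatest {x : ℕ | ∃ B : Fin (s + 1) → Finset (Finset (Fin n)),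
        (∀ i, ∀ A ∈ B i, A.card = k) ∧
        (∀ i j : Fin (s + 1), i ≤ j → B i ⊆ B j) ∧
        ¬ HasRainbowMatching B (s + 1) ∧
        x = p * (B 0).card + ∑ i : Fin s, (B i.succ).card}
      ((Finset.range (s + 1)).sup fun i =>
        (p + s) * n.choose k - (p + i) * (n - i).choose k) := by
  constructor
  · obtain ⟨i, hi, hsup⟩ := Finset.exists_mem_eq_sup (Finset.range (s + 1)) ⟨0, by simp⟩
      fun i => (p + s) * n.choose k - (p + i) * (n - i).choose k
    have hi : i ≤ s := by simpa [Nat.lt_succ_iff] using hi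
    have hsn : s ≤ n := by nlinarith [Nat.mul_le_mul_left s (Nat.pow_le_pow_left hk 2)]
    rw [hsup]
    refine ⟨OverlappingFamilies.extremal n k s i, fun j A hA => ?_, fun j l hjl => ?_,
      OverlappingFamilies.not_hasRainbowMatching_extremal hi,
      (OverlappingFamilies.weight_extremal hi (hi.trans hsn) p k).symm⟩
    · rw [OverlappingFamilies.extremal] at hA
      split_ifs at hA
      · exact (Finset.mem_powersetCard.1 (Finset.mem_filter.1 hA).1).2
      · exact (Finset.mem_powersetCard.1 hA).2
    · have hjl : (j : ℕ) ≤ l := hjl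
      unfold OverlappingFamilies.extremal
      split_ifs
      · exact subset_rfl
      · exact Finset.filter_subset _ _
      · omega
      · exact subset_rfl
  · rintro x ⟨B, hcard, hmono, hno, rfl⟩
    obtain ⟨i, hi, hw⟩ := OverlappingFamilies.exists_index_weight_le hk s Finset.univ p
      (fun j => if h : j < s + 1 then B ⟨j, h⟩ else ∅) (by simpa using hn)
      (fun j hj A hA => by
        rw [dif_pos (Nat.lt_succ_of_le hj)] at hA
        exact Finset.mem_powersetCard.2 ⟨Finset.subset_univ _, hcard _ _ hA⟩)
      (fun i j hij hj => by
        rw [dif_pos (show i < s + 1 by omega), dif_pos (show j < s + 1 by omega)]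
        exact hmono _ _ hij)
      (by
        rintro ⟨f, hf, hd⟩
        refine hno ⟨id, fun a => f a, strictMono_id, fun a => ?_, fun a b hab => ?_⟩
        · simpa only [dif_pos a.isLt, Fin.eta, id] using hf a (Finset.mem_range.2 a.isLt)
        · exact hd (Finset.mem_coe.2 (Finset.mem_range.2 a.isLt))
            (Finset.mem_coe.2 (Finset.mem_range.2 b.isLt)) (by simpa [Fin.ext_iff] using hab))
    refine le_trans ?_ (Finset.le_sup (f := fun i =>
      (p + s) * n.choose k - (p + i) * (n - i).choose k)
      (Finset.mem_range.2 (Nat.lt_succ_of_le hi)))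
    rw [← Fin.sum_univ_eq_sum_range
      (fun j => (if h : j + 1 < s + 1 then B ⟨j + 1, h⟩ else ∅).card)] at hw
    simp only [Finset.card_univ, Fintype.card_fin, Nat.zero_lt_succ, dif_pos,
      Nat.add_lt_add_iff_right, Fin.is_lt] at hw
    exact Nat.le_sub_of_add_le (by rw [add_comm]; exact hw)
end
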